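/- arXiv:1405.0998 — 2 statements merged into one kernel-verified Lean document; each statement's English description precedes it below -/
import Mathlib

section
/- For all integers k ≥ 0 and j ≥ 0 with k + j ≥ 1, let g_2 = z · (x + y − k·z)(x + y − (k−1)·z) · ∏_{s=−j}^{k+j} (x − s·z)(y − s·z) ∈ S, the defining polynomial of the cone over the arrangement A_2 obtained from the grid by adding the two diagonal lines x+y = k·z and x+y = (k−1)·z. Then D_0(g_2) is a free S-module of rank 2 admitting a basis consisting of two derivations each homogeneous of degree k+2j+2. (Equivalently, F_2 := T_{A_2}(k+2j+2) ≅ O_{ℙ²}^2.) -/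
open MvPolynomial

noncomputable section

abbrev S := MvPolynomial (Fin 3) ℝ

/-- The module of logarithmic derivations annihilating `f`. -/
def D0 (f : S) : Submodule S (Derivation ℝ S S) where
  carrier := {θ | θ f = 0}
  add_mem' := by
    intro a b ha hb
    simp only [Set.mem_setOf_eq] at *
    simp [ha, hb]
  zero_mem' := by simp
  smul_mem' := by
    intro c θ hθ
    simp only [Set.mem_setOf_eq] at *
    simp [hθ]

/-- A derivation is homogeneous of degree `d` if its values on the variables are
homogeneous of degree `d`. -/
def IsHomogDer (θ : Derivation ℝ S S) (d : ℕ) : Prop :=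
  ∀ i : Fin 3, (θ (X i)).IsHomogeneous d


/-- Defining polynomial of the cone over the arrangement `A_2`: the grid plus the two
diagonal lines `x + y = k·z` and `x + y = (k-1)·z`. -/
def g2Poly (j k : ℕ) : S :=
  X 2 * (X 0 + X 1 - C (k : ℝ) * X 2) * (X 0 + X 1 - C ((k : ℝ) - 1) * X 2) *
    ∏ s ∈ Finset.Icc (-(j : ℤ)) ((k : ℤ) + j),
      ((X 0 - C (s : ℝ) * X 2) * (X 1 - C (s : ℝ) * X 2))


/-- The product of the grid lines in the direction `w`. -/
def pg (n j : ℕ) (w : S) : S := ∏ i ∈ Finset.range n, (w - C ((i : ℝ) - j) * X 2)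

def H1 (k : ℕ) : S := X 0 + X 1 - C (k : ℝ) * X 2
def H2 (k : ℕ) : S := X 0 + X 1 - C ((k : ℝ) - 1) * X 2
def LL (j : ℕ) : S := X 0 + C ((j : ℝ) + 1) * X 2

lemma g2Poly_eq (j k : ℕ) : g2Poly j k =
    X 2 * H1 k * H2 k * (pg (k + 2 * j + 1) j (X 0) * pg (k + 2 * j + 1) j (X 1)) := by
  unfold g2Poly pg H1 H2
  rw [← Finset.prod_mul_distrib, Int.Icc_eq_finset_map, Finset.prod_map]
  have : ((k : ℤ) + j + 1 - -(j : ℤ)).toNat = k + 2 * j + 1 := by omega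
  rw [this]
  refine congrArg₂ (· * ·) rfl (Finset.prod_congr rfl fun i _ => ?_)
  simp [sub_eq_neg_add]

lemma prime_of_lin {l : S} (h : l.IsHomogeneous 1) (h0 : l ≠ 0) : Prime l := by
  refine Irreducible.prime (irreducible_of_totalDegree_eq_one (R := ℝ) (n := Fin 3)
    (h.totalDegree h0) ?_)
  intro x hx
  rw [isUnit_iff_ne_zero]
  rintro rfl
  apply h0
  ext i
  simpa using hx i

lemma homog_quot {l c : S} {n : ℕ} (h : l.IsHomogeneous 1) (h0 : l ≠ 0)
    (hc : (l * c).IsHomogeneous (n + 1)) : c.IsHomogeneous n := by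
  have key : homogeneousComponent (n + 1) (l * c) = l * homogeneousComponent n c := by
    conv_lhs => rw [← sum_homogeneousComponent c, Finset.mul_sum, map_sum]
    have : ∀ i ∈ Finset.range (c.totalDegree + 1),
        homogeneousComponent (n + 1) (l * homogeneousComponent i c)
          = if i = n then l * homogeneousComponent n c else 0 := by
      intro i _
      have hh : (l * homogeneousComponent i c).IsHomogeneous (1 + i) :=
        h.mul (homogeneousComponent_isHomogeneous i c)
      rw [homogeneousComponent_of_mem hh]
      by_cases hi : i = n
      · subst hi; simp [add_comm]
      · rw [if_neg hi, if_neg (by omega)]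
    rw [Finset.sum_congr rfl this, Finset.sum_ite_eq']
    split_ifs with hn
    · rfl
    · rw [homogeneousComponent_eq_zero n c (by simpa [Nat.lt_succ_iff] using hn), mul_zero]
  rw [homogeneousComponent_eq_self hc] at key
  rw [mul_left_cancel₀ h0 key]
  exact homogeneousComponent_isHomogeneous n c

def LogQ (n : ℕ) (η : Derivation ℝ S S) (g : S) : Prop :=
  ∃ c : S, c.IsHomogeneous n ∧ η g = c * g

lemma LogQ.mul {n : ℕ} {η : Derivation ℝ S S} {g h : S} (hg : LogQ n η g) (hh : LogQ n η h) :
    LogQ n η (g * h) := by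
  obtain ⟨c, hc, e⟩ := hg
  obtain ⟨d, hd, e'⟩ := hh
  refine ⟨c + d, hc.add hd, ?_⟩
  rw [Derivation.leibniz, e, e']
  simp only [smul_eq_mul]; ring

lemma LogQ.prod {n : ℕ} {η : Derivation ℝ S S} {ι : Type} (s : Finset ι) (g : ι → S)
    (hg : ∀ i ∈ s, LogQ n η (g i)) : LogQ n η (∏ i ∈ s, g i) := by
  classical
  induction s using Finset.induction_on with
  | empty => exact ⟨0, isHomogeneous_zero _ _ _, by simp⟩
  | insert a s ha ih =>
    rw [Finset.prod_insert ha]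
    exact (hg a (by simp)).mul (ih fun i hi => hg i (by simp [hi]))

lemma LogQ.lin {n : ℕ} {η : Derivation ℝ S S} {l : S} (h : l.IsHomogeneous 1) (h0 : l ≠ 0)
    (hη : (η l).IsHomogeneous (n + 1)) (hd : l ∣ η l) : LogQ n η l := by
  obtain ⟨c, hc⟩ := hd
  refine ⟨c, homog_quot h h0 (hc ▸ hη), by rw [hc, mul_comm]⟩

lemma lin_dvd {l g f : S} {δ : Derivation ℝ S S} (hδ : δ f = 0) (h : l.IsHomogeneous 1)
    (h0 : l ≠ 0) (hf : f = l * g) (v : Fin 3 → ℝ) (hv : eval v l = 0) (hg : eval v g ≠ 0) :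
    l ∣ δ l := by
  rw [hf] at hδ
  rw [Derivation.leibniz] at hδ
  have : l ∣ g * δ l := ⟨- δ g, by simp only [smul_eq_mul] at hδ; linear_combination hδ⟩
  rcases (prime_of_lin h h0).dvd_or_dvd this with h | h
  · obtain ⟨q, rfl⟩ := h
    simp [hv] at hg
  · exact h

lemma not_dvd_of_eval {l g : S} (v : Fin 3 → ℝ) (hv : eval v l = 0) (hg : eval v g ≠ 0) :
    ¬ l ∣ g := by
  rintro ⟨q, rfl⟩
  simp [hv] at hg

lemma ne_zero_of_eval {g : S} (v : Fin 3 → ℝ) (hg : eval v g ≠ 0) : g ≠ 0 := by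
  rintro rfl; simp at hg

/-! homogeneity -/
lemma homog_line (i : Fin 3) (r : ℝ) : (X i - C r * X 2 : S).IsHomogeneous 1 :=
  (isHomogeneous_X _ _).sub (isHomogeneous_C_mul_X _ _)
lemma homog_H1 (k : ℕ) : (H1 k).IsHomogeneous 1 :=
  ((isHomogeneous_X _ _).add (isHomogeneous_X _ _)).sub (isHomogeneous_C_mul_X _ _)
lemma homog_H2 (k : ℕ) : (H2 k).IsHomogeneous 1 :=
  ((isHomogeneous_X _ _).add (isHomogeneous_X _ _)).sub (isHomogeneous_C_mul_X _ _)
lemma homog_LL (j : ℕ) : (LL j).IsHomogeneous 1 :=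
  (isHomogeneous_X _ _).add (isHomogeneous_C_mul_X _ _)
lemma homog_pg (n j : ℕ) (i : Fin 3) : (pg n j (X i)).IsHomogeneous n := by
  have := IsHomogeneous.prod (Finset.range n) (fun t : ℕ => (X i - C ((t : ℝ) - j) * X 2 : S))
    (fun _ => 1) (fun t _ => homog_line i _)
  simpa [pg] using this

lemma line_ne (i : Fin 3) (hi : i ≠ 2) (r : ℝ) : (X i - C r * X 2 : S) ≠ 0 :=
  ne_zero_of_eval (fun t => if t = 2 then 0 else 1) (by simp [hi])
lemma H1_ne (k : ℕ) : H1 k ≠ 0 := ne_zero_of_eval ![1, 0, 0] (by simp [H1])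
lemma H2_ne (k : ℕ) : H2 k ≠ 0 := ne_zero_of_eval ![1, 0, 0] (by simp [H2])

/-! the reflection identities -/
lemma prod_refl {R : Type*} [CommRing R] (n : ℕ) (f g : ℕ → R)
    (h : ∀ i < n, f (n - 1 - i) = - g i) :
    ∏ i ∈ Finset.range n, f i = (-1) ^ n * ∏ i ∈ Finset.range n, g i := by
  rw [← Finset.prod_range_reflect]
  rw [Finset.prod_congr rfl fun i hi => h i (Finset.mem_range.1 hi), Finset.prod_neg,
    Finset.card_range]

lemma dvd1 (k j : ℕ) : H1 k ∣ pg (k + 2 * j + 1) j (X 1) -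
    (-1) ^ (k + 2 * j + 1) * pg (k + 2 * j + 1) j (X 0) := by
  rw [← Ideal.mem_span_singleton, ← Ideal.Quotient.eq]
  have h : Ideal.Quotient.mk (Ideal.span {H1 k}) (H1 k) = 0 := by
    rw [Ideal.Quotient.eq_zero_iff_mem, Ideal.mem_span_singleton]
  rw [pg, pg, map_mul, map_pow, map_neg, map_one, map_prod, map_prod]
  apply prod_refl
  intro i hi
  rw [← sub_eq_zero, ← h, ← map_neg, ← map_sub]
  congr 1
  have : ((k + 2 * j + 1 - 1 - i : ℕ) : ℝ) = k + 2 * j - i := by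
    rw [Nat.cast_sub (by omega)]; push_cast; simp
  rw [this, H1]
  simp only [C_sub, C_add, C_mul]
  have h2 : (C 2 : S) = 2 := rfl
  rw [h2]; ring

lemma dvd2 (k j : ℕ) : H2 k ∣ (LL j + ((k + 2 * j + 1 : ℕ) : S) * H1 k) *
      pg (k + 2 * j + 1) j (X 1) -
    (-1) ^ (k + 2 * j + 1) * LL j * pg (k + 2 * j + 1) j (X 0) := by
  rw [← Ideal.mem_span_singleton, ← Ideal.Quotient.eq]
  have h : Ideal.Quotient.mk (Ideal.span {H2 k}) (H2 k) = 0 := by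
    rw [Ideal.Quotient.eq_zero_iff_mem, Ideal.mem_span_singleton]
  have e1 : Ideal.Quotient.mk (Ideal.span {H2 k}) (pg (k + 2 * j + 1) j (X 1)) =
      (-1) ^ (k + 2 * j + 1) * ∏ i ∈ Finset.range (k + 2 * j + 1),
        Ideal.Quotient.mk (Ideal.span {H2 k}) (X 0 - C ((i : ℝ) - j - 1) * X 2) := by
    rw [pg, map_prod]
    apply prod_refl
    intro i hi
    rw [← sub_eq_zero, ← h, ← map_neg, ← map_sub]
    congr 1
    have : ((k + 2 * j + 1 - 1 - i : ℕ) : ℝ) = k + 2 * j - i := by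
      rw [Nat.cast_sub (by omega)]; push_cast; simp
    rw [this, H2]
    simp only [C_sub, C_add, C_mul]
    have h2 : (C 2 : S) = 2 := rfl
    rw [h2]; ring
  have e2 : Ideal.Quotient.mk (Ideal.span {H2 k}) (LL j + ((k + 2 * j + 1 : ℕ) : S) * H1 k) =
      Ideal.Quotient.mk (Ideal.span {H2 k})
        (X 0 - C (((k + 2 * j + 1 : ℕ) : ℝ) - j - 1) * X 2) := by
    rw [Ideal.Quotient.eq, Ideal.mem_span_singleton]
    refine ⟨((k + 2 * j + 1 : ℕ) : S), ?_⟩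
    rw [H2, H1, LL]
    simp only [C_sub, C_add, C_mul, C_1, map_natCast]
    push_cast
    ring
  rw [map_mul, e1, e2, map_mul, map_mul, map_pow, map_neg, map_one, pg, map_prod]
  have e3 := Finset.prod_range_succ (fun i : ℕ => Ideal.Quotient.mk (Ideal.span {H2 k})
    (X 0 - C ((i : ℝ) - j - 1) * X 2)) (k + 2 * j + 1)
  rw [Finset.prod_range_succ'] at e3
  have e4 : ∀ i : ℕ, ((i + 1 : ℕ) : ℝ) - j - 1 = i - j := by intro i; push_cast; ring
  have e5 : (X 0 - C (((0 : ℕ) : ℝ) - j - 1) * X 2 : S) = LL j := by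
    rw [LL]; simp only [C_sub, C_add, Nat.cast_zero, C_0]; ring
  simp only [e4, e5] at e3
  rw [e4 (k + 2 * j)]
  linear_combination (-1) ^ (k + 2 * j + 1) * (-e3)

def eta (a b : S) : Derivation ℝ S S := mkDerivation ℝ ![a, b, 0]
def EE : Derivation ℝ S S := mkDerivation ℝ X

lemma eta_0 (a b : S) : eta a b (X 0) = a := by simp [eta, mkDerivation_X]
lemma eta_1 (a b : S) : eta a b (X 1) = b := by simp [eta, mkDerivation_X]
lemma eta_2 (a b : S) : eta a b (X 2) = 0 := by simp [eta, mkDerivation_X]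
lemma EE_X (i : Fin 3) : EE (X i) = X i := by simp [EE, mkDerivation_X]

lemma der_C (δ : Derivation ℝ S S) (r : ℝ) : δ (C r) = 0 := derivation_C _ _

lemma der_line (δ : Derivation ℝ S S) (w : S) (r : ℝ) :
    δ (w - C r * X 2) = δ w - C r * δ (X 2) := by
  rw [map_sub, Derivation.leibniz, der_C]; simp

lemma logq_eta (k j : ℕ) {a b : S} (ha : a.IsHomogeneous (k + 2 * j + 2))
    (hb : b.IsHomogeneous (k + 2 * j + 2))
    (hpa : pg (k + 2 * j + 1) j (X 0) ∣ a) (hpb : pg (k + 2 * j + 1) j (X 1) ∣ b)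
    (h1 : H1 k ∣ a + b) (h2 : H2 k ∣ a + b) :
    LogQ (k + 2 * j + 1) (eta a b) (g2Poly j k) := by
  rw [g2Poly_eq]
  refine LogQ.mul (LogQ.mul (LogQ.mul ?_ ?_) ?_) (LogQ.mul ?_ ?_)
  · exact ⟨0, isHomogeneous_zero _ _ _, by rw [eta_2, zero_mul]⟩
  · have : eta a b (H1 k) = a + b := by
      rw [H1, der_line, map_add, eta_0, eta_1, eta_2, mul_zero, sub_zero]
    exact LogQ.lin (homog_H1 k) (H1_ne k) (this ▸ ha.add hb) (this ▸ h1)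
  · have : eta a b (H2 k) = a + b := by
      rw [H2, der_line, map_add, eta_0, eta_1, eta_2, mul_zero, sub_zero]
    exact LogQ.lin (homog_H2 k) (H2_ne k) (this ▸ ha.add hb) (this ▸ h2)
  · refine LogQ.prod _ _ fun i hi => ?_
    have : eta a b (X 0 - C ((i : ℝ) - j) * X 2) = a := by
      rw [der_line, eta_0, eta_2, mul_zero, sub_zero]
    refine LogQ.lin (homog_line _ _) (line_ne _ (by decide) _) (this.symm ▸ ha) ?_
    rw [this]
    exact (Finset.dvd_prod_of_mem (fun i : ℕ => (X 0 - C ((i : ℝ) - j) * X 2 : S)) hi).trans hpa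
  · refine LogQ.prod _ _ fun i hi => ?_
    have : eta a b (X 1 - C ((i : ℝ) - j) * X 2) = b := by
      rw [der_line, eta_1, eta_2, mul_zero, sub_zero]
    refine LogQ.lin (homog_line _ _) (line_ne _ (by decide) _) (this.symm ▸ hb) ?_
    rw [this]
    exact (Finset.dvd_prod_of_mem (fun i : ℕ => (X 1 - C ((i : ℝ) - j) * X 2 : S)) hi).trans hpb

lemma homog_g2 (j k : ℕ) : (g2Poly j k).IsHomogeneous (2 * (k + 2 * j + 1) + 3) := by
  rw [g2Poly_eq]
  have := (((isHomogeneous_X ℝ (2 : Fin 3)).mul (homog_H1 k)).mul (homog_H2 k)).mul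
    ((homog_pg (k + 2 * j + 1) j 0).mul (homog_pg (k + 2 * j + 1) j 1))
  convert this using 1
  ring

lemma EE_g2 (j k : ℕ) : EE (g2Poly j k) = C ((2 * (k + 2 * j + 1) + 3 : ℕ) : ℝ) * g2Poly j k := by
  have h := (homog_g2 j k).sum_X_mul_pderiv
  rw [nsmul_eq_mul] at h
  have hE : EE = (X 0 : S) • pderiv 0 + (X 1 : S) • pderiv 1 + (X 2 : S) • pderiv 2 := by
    apply derivation_ext
    intro i
    rw [EE_X]
    fin_cases i <;> simp [pderiv_X]
  rw [map_natCast, ← h, hE, Fin.sum_univ_three]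
  simp

lemma eval_pg (n j : ℕ) (w : S) (v : Fin 3 → ℝ)
    (h : ∀ i : ℕ, eval v w ≠ ((i : ℝ) - j) * v 2) : eval v (pg n j w) ≠ 0 := by
  rw [pg, map_prod, Finset.prod_ne_zero_iff]
  intro i _
  simpa [sub_eq_zero] using h i

lemma g2_ne (j k : ℕ) : g2Poly j k ≠ 0 := by
  rw [g2Poly_eq]
  have h (i : Fin 3) (hi : i ≠ 2) : pg (k + 2 * j + 1) j (X i) ≠ 0 :=
    Finset.prod_ne_zero_iff.2 fun t _ => line_ne i hi _
  exact mul_ne_zero (mul_ne_zero (mul_ne_zero (X_ne_zero _) (H1_ne k)) (H2_ne k))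
    (mul_ne_zero (h 0 (by decide)) (h 1 (by decide)))

lemma pg_dvd (n j : ℕ) (w : Fin 3) (hw : w ≠ 2) (a : S)
    (h : ∀ i < n, (X w - C ((i : ℝ) - j) * X 2 : S) ∣ a) : pg n j (X w) ∣ a := by
  refine Finset.prod_dvd_of_isRelPrime ?_ fun i hi => h i (Finset.mem_range.1 hi)
  intro s _ t _ hst
  have hp := prime_of_lin (homog_line w ((s : ℝ) - j)) (line_ne w hw _)
  refine (hp.irreducible.isRelPrime_iff_not_dvd).2 ?_
  refine not_dvd_of_eval (fun i => if i = 2 then 1 else (s : ℝ) - j) (by simp [hw]) ?_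
  simp [hw, sub_eq_zero]
  exact_mod_cast hst

lemma converse (j k : ℕ) (δ : Derivation ℝ S S) (hδ : δ (g2Poly j k) = 0) :
    ∃ e A B : S, δ (X 0) = e * X 0 + A * pg (k + 2 * j + 1) j (X 0) ∧
      δ (X 1) = e * X 1 + B * pg (k + 2 * j + 1) j (X 1) ∧ δ (X 2) = e * X 2 ∧
      H1 k ∣ A * pg (k + 2 * j + 1) j (X 0) + B * pg (k + 2 * j + 1) j (X 1) ∧
      H2 k ∣ A * pg (k + 2 * j + 1) j (X 0) + B * pg (k + 2 * j + 1) j (X 1) := by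
  rw [g2Poly_eq] at hδ
  set n := k + 2 * j + 1 with hn
  have hz : (X 2 : S) ∣ δ (X 2) := by
    refine lin_dvd hδ (isHomogeneous_X _ _) (X_ne_zero _)
      (g := H1 k * H2 k * (pg n j (X 0) * pg n j (X 1))) (by ring)
      ![1, 1, 0] (by simp) ?_
    rw [map_mul, map_mul, map_mul]
    refine mul_ne_zero (mul_ne_zero ?_ ?_) (mul_ne_zero (eval_pg _ _ _ _ ?_) (eval_pg _ _ _ _ ?_))
    · simp [H1]
    · simp [H2]
    · simp
    · simp
  have hH1 : H1 k ∣ δ (H1 k) := by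
    refine lin_dvd hδ (homog_H1 k) (H1_ne k)
      (g := X 2 * H2 k * (pg n j (X 0) * pg n j (X 1))) (by ring)
      ![1 / 4, k - 1 / 4, 1] (by simp [H1]) ?_
    rw [map_mul, map_mul, map_mul]
    refine mul_ne_zero (mul_ne_zero ?_ ?_) (mul_ne_zero (eval_pg _ _ _ _ ?_) (eval_pg _ _ _ _ ?_))
    · simp
    · simp [H2]
    · intro i h
      simp at h
      have : (1 : ℝ) = 4 * (i - j) := by linarith
      have : (1 : ℤ) = 4 * (i - j) := by exact_mod_cast this
      omega
    · intro i h
      simp at h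
      have : (-1 : ℝ) = 4 * (i - j - k) := by linarith
      have : (-1 : ℤ) = 4 * (i - j - k) := by exact_mod_cast this
      omega
  have hH2 : H2 k ∣ δ (H2 k) := by
    refine lin_dvd hδ (homog_H2 k) (H2_ne k)
      (g := X 2 * H1 k * (pg n j (X 0) * pg n j (X 1))) (by ring)
      ![1 / 4, k - 1 - 1 / 4, 1] (by simp [H2]) ?_
    rw [map_mul, map_mul, map_mul]
    refine mul_ne_zero (mul_ne_zero ?_ ?_) (mul_ne_zero (eval_pg _ _ _ _ ?_) (eval_pg _ _ _ _ ?_))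
    · simp
    · simp [H1]
    · intro i h
      simp at h
      have : (1 : ℝ) = 4 * (i - j) := by linarith
      have : (1 : ℤ) = 4 * (i - j) := by exact_mod_cast this
      omega
    · intro i h
      simp at h
      have : (-5 : ℝ) = 4 * (i - j - k) := by linarith
      have : (-5 : ℤ) = 4 * (i - j - k) := by exact_mod_cast this
      omega
  have hsplit : ∀ (w : S) (i : ℕ), i < n → pg n j w = (w - C ((i : ℝ) - j) * X 2) *
      ∏ t ∈ (Finset.range n).erase i, (w - C ((t : ℝ) - j) * X 2) := by
    intro w i hi
    rw [pg, Finset.mul_prod_erase (Finset.range n) (fun t : ℕ => w - C ((t : ℝ) - j) * X 2)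
      (Finset.mem_range.2 hi)]
  have hx : ∀ i < n, (X 0 - C ((i : ℝ) - j) * X 2 : S) ∣ δ (X 0 - C ((i : ℝ) - j) * X 2) := by
    intro i hi
    refine lin_dvd hδ (homog_line 0 _) (line_ne 0 (by decide) _)
      (g := X 2 * H1 k * H2 k *
        ((∏ t ∈ (Finset.range n).erase i, (X 0 - C ((t : ℝ) - j) * X 2)) * pg n j (X 1)))
      (by rw [hsplit (X 0) i hi]; ring)
      ![i - j, 1 / 4, 1] (by simp) ?_
    rw [map_mul, map_mul, map_mul, map_mul]
    refine mul_ne_zero (mul_ne_zero (mul_ne_zero ?_ ?_) ?_) (mul_ne_zero ?_ (eval_pg _ _ _ _ ?_))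
    · simp
    · intro h
      simp [H1] at h
      have : (-1 : ℝ) = 4 * (i - j - k) := by linarith
      have : (-1 : ℤ) = 4 * (i - j - k) := by exact_mod_cast this
      omega
    · intro h
      simp [H2] at h
      have : (-5 : ℝ) = 4 * (i - j - k) := by linarith
      have : (-5 : ℤ) = 4 * (i - j - k) := by exact_mod_cast this
      omega
    · rw [map_prod, Finset.prod_ne_zero_iff]
      intro t ht
      have := Finset.ne_of_mem_erase ht
      simp [sub_eq_zero]
      exact_mod_cast this.symm
    · intro i h
      simp at h
      have : (1 : ℝ) = 4 * (i - j) := by linarith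
      have : (1 : ℤ) = 4 * (i - j) := by exact_mod_cast this
      omega
  have hy : ∀ i < n, (X 1 - C ((i : ℝ) - j) * X 2 : S) ∣ δ (X 1 - C ((i : ℝ) - j) * X 2) := by
    intro i hi
    refine lin_dvd hδ (homog_line 1 _) (line_ne 1 (by decide) _)
      (g := X 2 * H1 k * H2 k *
        (pg n j (X 0) * (∏ t ∈ (Finset.range n).erase i, (X 1 - C ((t : ℝ) - j) * X 2))))
      (by rw [hsplit (X 1) i hi]; ring)
      ![1 / 4, i - j, 1] (by simp) ?_
    rw [map_mul, map_mul, map_mul, map_mul]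
    refine mul_ne_zero (mul_ne_zero (mul_ne_zero ?_ ?_) ?_) (mul_ne_zero (eval_pg _ _ _ _ ?_) ?_)
    · simp
    · intro h
      simp [H1] at h
      have : (-1 : ℝ) = 4 * (i - j - k) := by linarith
      have : (-1 : ℤ) = 4 * (i - j - k) := by exact_mod_cast this
      omega
    · intro h
      simp [H2] at h
      have : (-5 : ℝ) = 4 * (i - j - k) := by linarith
      have : (-5 : ℤ) = 4 * (i - j - k) := by exact_mod_cast this
      omega
    · intro i h
      simp at h
      have : (1 : ℝ) = 4 * (i - j) := by linarith
      have : (1 : ℤ) = 4 * (i - j) := by exact_mod_cast this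
      omega
    · rw [map_prod, Finset.prod_ne_zero_iff]
      intro t ht
      have := Finset.ne_of_mem_erase ht
      simp [sub_eq_zero]
      exact_mod_cast this.symm
  obtain ⟨e, he⟩ := hz
  have hA : pg n j (X 0) ∣ δ (X 0) - e * X 0 := by
    refine pg_dvd n j 0 (by decide) _ fun i hi => ?_
    obtain ⟨q, hq⟩ := hx i hi
    rw [der_line, he] at hq
    exact ⟨q - e, by linear_combination hq⟩
  have hB : pg n j (X 1) ∣ δ (X 1) - e * X 1 := by
    refine pg_dvd n j 1 (by decide) _ fun i hi => ?_
    obtain ⟨q, hq⟩ := hy i hi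
    rw [der_line, he] at hq
    exact ⟨q - e, by linear_combination hq⟩
  obtain ⟨A, hA⟩ := hA
  obtain ⟨B, hB⟩ := hB
  refine ⟨e, A, B, by linear_combination hA, by linear_combination hB, by rw [he, mul_comm],
    ?_, ?_⟩
  · obtain ⟨q, hq⟩ := hH1
    have h' := der_line δ (X 0 + X 1) k
    rw [← H1, hq, map_add, he] at h'
    refine ⟨q - e, ?_⟩
    have hd : H1 k = X 0 + X 1 - C (k : ℝ) * X 2 := rfl
    linear_combination -hA - hB - h' + e * hd
  · obtain ⟨q, hq⟩ := hH2
    have h' := der_line δ (X 0 + X 1) (k - 1)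
    rw [← H2, hq, map_add, he] at h'
    refine ⟨q - e, ?_⟩
    have hd : H2 k = X 0 + X 1 - C ((k : ℝ) - 1) * X 2 := rfl
    linear_combination -hA - hB - h' + e * hd

lemma not_H1_dvd_pg (j k n : ℕ) : ¬ H1 k ∣ pg n j (X 0) := by
  refine not_dvd_of_eval ![1 / 4, k - 1 / 4, 1] (by simp [H1]) (eval_pg _ _ _ _ ?_)
  intro i h
  simp at h
  have : (1 : ℝ) = 4 * (i - j) := by linarith
  have : (1 : ℤ) = 4 * (i - j) := by exact_mod_cast this
  omega

lemma not_H2_dvd_pg (j k n : ℕ) : ¬ H2 k ∣ pg n j (X 0) := by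
  refine not_dvd_of_eval ![1 / 4, k - 1 - 1 / 4, 1] (by simp [H2]) (eval_pg _ _ _ _ ?_)
  intro i h
  simp at h
  have : (1 : ℝ) = 4 * (i - j) := by linarith
  have : (1 : ℤ) = 4 * (i - j) := by exact_mod_cast this
  omega

lemma not_H2_dvd_z (k : ℕ) : ¬ H2 k ∣ X 2 :=
  not_dvd_of_eval ![1 / 4, k - 1 - 1 / 4, 1] (by simp [H2]) (by simp)

/-- Solving the two congruences. -/
lemma solve (j k : ℕ) (A B : S)
    (h1 : H1 k ∣ A * pg (k + 2 * j + 1) j (X 0) + B * pg (k + 2 * j + 1) j (X 1))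
    (h2 : H2 k ∣ A * pg (k + 2 * j + 1) j (X 0) + B * pg (k + 2 * j + 1) j (X 1)) :
    ∃ a b : S, A = a * H2 k - b * (-1) ^ (k + 2 * j + 1) * LL j ∧
      B = -a * (-1) ^ (k + 2 * j + 1) * H2 k +
        b * (LL j + ((k + 2 * j + 1 : ℕ) : S) * H1 k) := by
  have d1 := dvd1 k j
  have d2 := dvd2 k j
  have hnp := not_H1_dvd_pg j k (k + 2 * j + 1)
  have hnp2 := not_H2_dvd_pg j k (k + 2 * j + 1)
  have hH : H1 k = H2 k - X 2 := by rw [H1, H2, C_sub, C_1]; ring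
  set n := k + 2 * j + 1 with hn
  set P := pg n j (X 0)
  set Q := pg n j (X 1)
  set ε : S := (-1) ^ n with hε
  have hεε : ε * ε = 1 := by rw [hε, ← mul_pow]; simp
  have hnn : C ((n : ℝ)⁻¹) * (n : S) = 1 := by
    rw [← map_natCast (C : ℝ →+* S), ← C_mul, inv_mul_cancel₀ (by positivity), C_1]
  obtain ⟨q1, h1⟩ := h1
  obtain ⟨q2, h2⟩ := h2
  obtain ⟨r1, d1⟩ := d1
  obtain ⟨r2, d2⟩ := d2
  have : H1 k ∣ (A + ε * B) * P := ⟨q1 - B * r1, by linear_combination h1 - B * d1⟩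
  rcases (prime_of_lin (homog_H1 k) (H1_ne k)).dvd_or_dvd this with h | h
  swap
  · exact absurd h hnp
  obtain ⟨β', hβ'⟩ := h
  obtain ⟨β, hβ⟩ : ∃ β, B = -ε * A + β * H1 k :=
    ⟨ε * β', by linear_combination ε * hβ' - B * hεε⟩
  have hp2 := prime_of_lin (homog_H2 k) (H2_ne k)
  have : H2 k ∣ (X 2 * ((n : S) * A + ε * β * LL j)) * P := by
    refine ⟨P * ((n : S) * A + ε * β * LL j) - (q2 * (LL j + (n : S) * H1 k) - B * r2), ?_⟩
    linear_combination -(LL j + (n : S) * H1 k) * h2 + B * d2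
      + P * ((n : S) * A + ε * β * LL j) * hH + ε * LL j * P * hβ - A * LL j * P * hεε
  rcases hp2.dvd_or_dvd this with h | h
  swap
  · exact absurd h hnp2
  rcases hp2.dvd_or_dvd h with h | h
  · exact absurd h (not_H2_dvd_z k)
  obtain ⟨γ, hγ⟩ := h
  refine ⟨C ((n : ℝ)⁻¹) * γ, C ((n : ℝ)⁻¹) * β, ?_, ?_⟩
  · linear_combination C ((n : ℝ)⁻¹) * hγ - A * hnn
  · linear_combination hβ - ε * (C ((n : ℝ)⁻¹) * hγ) + (ε * A - β * H1 k) * hnn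
      + C ((n : ℝ)⁻¹) * β * LL j * hεε

/-- Correction of a logarithmic derivation by a multiple of the Euler derivation. -/
lemma correct (j k : ℕ) (η : Derivation ℝ S S) (h : LogQ (k + 2 * j + 1) η (g2Poly j k))
    (hη : IsHomogDer η (k + 2 * j + 2)) :
    ∃ c : S, (η - c • EE) ∈ D0 (g2Poly j k) ∧ IsHomogDer (η - c • EE) (k + 2 * j + 2) := by
  obtain ⟨c, hc, e⟩ := h
  have hN : C (((2 * (k + 2 * j + 1) + 3 : ℕ) : ℝ)⁻¹) * C ((2 * (k + 2 * j + 1) + 3 : ℕ) : ℝ)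
      = (1 : S) := by
    rw [← C_mul, inv_mul_cancel₀ (by positivity), C_1]
  refine ⟨C (((2 * (k + 2 * j + 1) + 3 : ℕ) : ℝ)⁻¹) * c, ?_, ?_⟩
  · change (η - _ • EE) (g2Poly j k) = 0
    rw [Derivation.sub_apply, Derivation.smul_apply, e, EE_g2, smul_eq_mul]
    linear_combination -(c * g2Poly j k) * hN
  · intro i
    rw [Derivation.sub_apply, Derivation.smul_apply, EE_X, smul_eq_mul]
    exact (hη i).sub ((hc.C_mul _).mul (isHomogeneous_X _ _))

lemma homog_eta {a b : S} {d : ℕ} (ha : a.IsHomogeneous d) (hb : b.IsHomogeneous d) :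
    IsHomogDer (eta a b) d := by
  intro i
  fin_cases i
  · exact (eta_0 a b).symm ▸ ha
  · exact (eta_1 a b).symm ▸ hb
  · exact (eta_2 a b).symm ▸ isHomogeneous_zero _ _ _

lemma homog_const {p : S} {d : ℕ} (hp : p.IsHomogeneous d) (n : ℕ) :
    ((-1) ^ n * p).IsHomogeneous d := by
  rcases neg_one_pow_eq_or S n with h | h <;> rw [h]
  · simpa using hp
  · simpa using hp.neg

lemma homog_nat {p : S} {d : ℕ} (hp : p.IsHomogeneous d) (n : ℕ) :
    ((n : S) * p).IsHomogeneous d := by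
  rw [← map_natCast (C : ℝ →+* S)]
  exact hp.C_mul _

/-- `A_2` is free with exponents `(k+2j+2, k+2j+2)`, i.e. `F_2 = T_{A_2}(k+2j+2) ≃ O^2`. -/
theorem grid_plus_two_diagonals_free (k j : ℕ) (hkj : 1 ≤ k + j) :
    ∃ θ : Fin 2 → Derivation ℝ S S,
      (∀ i, θ i ∈ D0 (g2Poly j k)) ∧
      (∀ i, IsHomogDer (θ i) (k + 2 * j + 2)) ∧
      (∀ δ ∈ D0 (g2Poly j k), ∃! a : Fin 2 → S, ∑ i, a i • θ i = δ) := by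
  obtain ⟨r1, d1⟩ := dvd1 k j
  obtain ⟨r2, d2⟩ := dvd2 k j
  have hconv := converse j k
  have hsolve := solve j k
  have hlog := @logq_eta k j
  have hcor := correct j k
  have hH : H1 k = H2 k - X 2 := by rw [H1, H2, C_sub, C_1]; ring
  have hPh := homog_pg (k + 2 * j + 1) j 0
  have hQh := homog_pg (k + 2 * j + 1) j 1
  have hP0 : pg (k + 2 * j + 1) j (X 0) ≠ 0 :=
    Finset.prod_ne_zero_iff.2 fun t _ => line_ne 0 (by decide) _
  have hQ0 : pg (k + 2 * j + 1) j (X 1) ≠ 0 :=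
    Finset.prod_ne_zero_iff.2 fun t _ => line_ne 1 (by decide) _
  have hdeg : k + 2 * j + 2 = 1 + (k + 2 * j + 1) := by ring
  have hn0 : ((k + 2 * j + 1 : ℕ) : S) ≠ 0 := Nat.cast_ne_zero.2 (by omega)
  have hεε : ((-1) ^ (k + 2 * j + 1) : S) * (-1) ^ (k + 2 * j + 1) = 1 := by
    rw [← mul_pow]; simp
  have hL := homog_LL j
  have hM : (LL j + ((k + 2 * j + 1 : ℕ) : S) * H1 k).IsHomogeneous 1 :=
    hL.add (homog_nat (homog_H1 k) _)
  have hLε := homog_const hL (k + 2 * j + 1)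
  have hHε := homog_const (homog_H2 k) (k + 2 * j + 1)
  generalize (-1 : S) ^ (k + 2 * j + 1) = ε at *
  generalize hPd : pg (k + 2 * j + 1) j (X 0) = P at *
  generalize hQd : pg (k + 2 * j + 1) j (X 1) = Q at *
  generalize ((k + 2 * j + 1 : ℕ) : S) = n at *
  have ha1 : (H2 k * P).IsHomogeneous (k + 2 * j + 2) := hdeg ▸ (homog_H2 k).mul hPh
  have hb1 : (-(ε * H2 k) * Q).IsHomogeneous (k + 2 * j + 2) := hdeg ▸ hHε.neg.mul hQh
  have ha2 : (-(ε * LL j) * P).IsHomogeneous (k + 2 * j + 2) := hdeg ▸ hLε.neg.mul hPh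
  have hb2 : ((LL j + n * H1 k) * Q).IsHomogeneous (k + 2 * j + 2) := hdeg ▸ hM.mul hQh
  obtain ⟨c1, m1, o1⟩ := hcor (eta (H2 k * P) (-(ε * H2 k) * Q))
    (hlog ha1 hb1 ⟨_, mul_comm _ _⟩ ⟨_, mul_comm _ _⟩
      ⟨-ε * H2 k * r1, by linear_combination -ε * H2 k * d1 - H2 k * P * hεε⟩
      ⟨P - ε * Q, by ring⟩) (homog_eta ha1 hb1)
  obtain ⟨c2, m2, o2⟩ := hcor (eta (-(ε * LL j) * P) ((LL j + n * H1 k) * Q))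
    (hlog ha2 hb2 ⟨_, mul_comm _ _⟩ ⟨_, mul_comm _ _⟩
      ⟨LL j * r1 + n * Q, by linear_combination LL j * d1⟩
      ⟨r2, by linear_combination d2⟩) (homog_eta ha2 hb2)
  have hx : ∀ a b : S, (a • (eta (H2 k * P) (-(ε * H2 k) * Q) - c1 • EE) +
      b • (eta (-(ε * LL j) * P) ((LL j + n * H1 k) * Q) - c2 • EE)) (X 0) =
      a * (H2 k * P) + b * (-(ε * LL j) * P) - (a * c1 + b * c2) * X 0 := by
    intro a b
    simp only [Derivation.add_apply, Derivation.smul_apply, Derivation.sub_apply, eta_0, EE_X,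
      smul_eq_mul]
    ring
  have hy : ∀ a b : S, (a • (eta (H2 k * P) (-(ε * H2 k) * Q) - c1 • EE) +
      b • (eta (-(ε * LL j) * P) ((LL j + n * H1 k) * Q) - c2 • EE)) (X 1) =
      a * (-(ε * H2 k) * Q) + b * ((LL j + n * H1 k) * Q) - (a * c1 + b * c2) * X 1 := by
    intro a b
    simp only [Derivation.add_apply, Derivation.smul_apply, Derivation.sub_apply, eta_1, EE_X,
      smul_eq_mul]
    ring
  have hz : ∀ a b : S, (a • (eta (H2 k * P) (-(ε * H2 k) * Q) - c1 • EE) +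
      b • (eta (-(ε * LL j) * P) ((LL j + n * H1 k) * Q) - c2 • EE)) (X 2) =
      - (a * c1 + b * c2) * X 2 := by
    intro a b
    simp only [Derivation.add_apply, Derivation.smul_apply, Derivation.sub_apply, eta_2, EE_X,
      smul_eq_mul]
    ring
  generalize hθ1 : eta (H2 k * P) (-(ε * H2 k) * Q) - c1 • EE = θ1 at *
  generalize hθ2 : eta (-(ε * LL j) * P) ((LL j + n * H1 k) * Q) - c2 • EE = θ2 at *
  have indep : ∀ a b : S, a • θ1 + b • θ2 = 0 → a = 0 ∧ b = 0 := by
    intro a b h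
    have ex := hx a b
    have ey := hy a b
    have ez := hz a b
    rw [h, Derivation.zero_apply] at ex ey ez
    have h0 : a * c1 + b * c2 = 0 := by
      have := mul_eq_zero.1 ez.symm
      rcases this with h | h
      · linear_combination -h
      · exact absurd h (X_ne_zero _)
    rw [h0] at ex ey
    have e1 : a * H2 k - b * ε * LL j = 0 := by
      apply mul_right_cancel₀ hP0
      linear_combination -ex
    have e2 : -a * ε * H2 k + b * (LL j + n * H1 k) = 0 := by
      apply mul_right_cancel₀ hQ0
      linear_combination -ey
    have hb : b * (n * H1 k) = 0 := by linear_combination e2 + ε * e1 + b * LL j * hεε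
    have hb0 : b = 0 := by
      rcases mul_eq_zero.1 hb with h | h
      · exact h
      · exact absurd h (mul_ne_zero hn0 (H1_ne k))
    refine ⟨?_, hb0⟩
    rw [hb0] at e1
    have : a * H2 k = 0 := by linear_combination e1
    rcases mul_eq_zero.1 this with h | h
    · exact h
    · exact absurd h (H2_ne k)
  refine ⟨![θ1, θ2], ?_, ?_, ?_⟩
  · intro i; fin_cases i
    · exact m1
    · exact m2
  · intro i; fin_cases i
    · exact o1
    · exact o2
  intro δ hδ
  obtain ⟨e, A, B, dx, dy, dz, s1, s2⟩ := hconv δ hδ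
  obtain ⟨a, b, hA, hB⟩ := hsolve A B s1 s2
  have hE : δ = a • θ1 + b • θ2 + (e + (a * c1 + b * c2)) • EE := by
    apply derivation_ext
    intro i
    rw [Derivation.add_apply, Derivation.smul_apply, EE_X, smul_eq_mul]
    fin_cases i
    · change δ (X 0) = (a • θ1 + b • θ2) (X 0) + _ * X 0
      rw [hx, dx, hA]; ring
    · change δ (X 1) = (a • θ1 + b • θ2) (X 1) + _ * X 1
      rw [hy, dy, hB]; ring
    · change δ (X 2) = (a • θ1 + b • θ2) (X 2) + _ * X 2
      rw [hz, dz]; ring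
  have he : e + (a * c1 + b * c2) = 0 := by
    have h0 : δ (g2Poly j k) = 0 := hδ
    have h1 : θ1 (g2Poly j k) = 0 := m1
    have h2 : θ2 (g2Poly j k) = 0 := m2
    rw [hE] at h0
    simp only [Derivation.add_apply, Derivation.smul_apply, h1, h2, EE_g2, smul_eq_mul, mul_zero,
      zero_add] at h0
    rcases mul_eq_zero.1 h0 with h | h
    · exact h
    · refine absurd h (mul_ne_zero ?_ (g2_ne j k))
      rw [Ne, C_eq_zero]
      positivity
  rw [he, zero_smul, add_zero] at hE
  refine ⟨![a, b], ?_, ?_⟩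
  · change ∑ i, ![a, b] i • ![θ1, θ2] i = δ
    rw [Fin.sum_univ_two, hE]; rfl
  · intro f hf
    change ∑ i, f i • ![θ1, θ2] i = δ at hf
    rw [Fin.sum_univ_two] at hf
    have hf' : f 0 • θ1 + f 1 • θ2 = δ := hf
    have := indep (f 0 - a) (f 1 - b) (by
      rw [hE] at hf'
      ext1 i
      have h := DFunLike.congr_fun hf' (X i)
      simp only [Derivation.add_apply, Derivation.smul_apply, Derivation.zero_apply,
        smul_eq_mul] at h ⊢
      linear_combination h)
    funext i
    fin_cases i
    · exact sub_eq_zero.1 this.1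
    · exact sub_eq_zero.1 this.2
end
end

section
/- For all integers k ≥ 3 and j ≥ 0, and for each of the six linear forms ℓ ∈ { x − (k+j)·z, y − (k+j)·z, x + y + j·z, x + (j+1)·z, y + (j+1)·z, x + y − (k+j+1)·z }, there exists a surjective S-linear map ψ : D_0(f_{j,k}) → S/(ℓ) such that for every d and every θ ∈ D_0(f_{j,k}) homogeneous of degree d, ψ(θ) is the class modulo ℓ of a homogeneous polynomial of degree d − (2k+1+3j) (in particular ψ(θ) = 0 when d < 2k+1+3j). (This expresses that the six lines x = (k+j)z, y = (k+j)z, x+y = −jz, x = −(j+1)z, y = −(j+1)z, x+y = (k+j+1)z are unstable lines of the Steiner bundle T_A(2k+1+3j), i.e. the bundle admits a surjection onto O_L for each such line L.) -/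
open MvPolynomial

noncomputable section

def fjk (j k : ℕ) : S :=
  X 2 * ∏ s ∈ Finset.Icc (-(j : ℤ)) ((k : ℤ) + j),
    ((X 0 - C (s : ℝ) * X 2) * (X 1 - C (s : ℝ) * X 2) * (X 0 + X 1 - C (s : ℝ) * X 2))

/-- Graded extraction. -/
lemma grade_extract (ℓ B T g : S) (b e : ℕ) (hℓ : ℓ.IsHomogeneous 1) (hB : B.IsHomogeneous b)
    (hT : T.IsHomogeneous e) (h : ℓ ∣ T - B * g) :
    (b ≤ e → ∃ g' : S, g'.IsHomogeneous (e - b) ∧ ℓ ∣ T - B * g') ∧ (e < b → ℓ ∣ T) := by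
  let := MvPolynomial.gradedAlgebra (σ := Fin 3) (R := ℝ)
  obtain ⟨q, hq⟩ := h
  have hT' : T = B * g + ℓ * q := by rw [← hq]; ring
  have key : T = (DirectSum.decompose (homogeneousSubmodule (Fin 3) ℝ) (B * g) e : S)
      + (DirectSum.decompose (homogeneousSubmodule (Fin 3) ℝ) (ℓ * q) e : S) := by
    have h1 : T = (DirectSum.decompose (homogeneousSubmodule (Fin 3) ℝ) T e : S) :=
      (DirectSum.decompose_of_mem_same (homogeneousSubmodule (Fin 3) ℝ)
        ((mem_homogeneousSubmodule _ _).2 hT)).symm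
    conv_lhs => rw [h1, hT']
    simp [DirectSum.decompose_add]
  have hl2 : ℓ ∣ (DirectSum.decompose (homogeneousSubmodule (Fin 3) ℝ) (ℓ * q) e : S) := by
    rw [DirectSum.coe_decompose_mul_of_left_mem (homogeneousSubmodule (Fin 3) ℝ) e
      ((mem_homogeneousSubmodule _ _).2 hℓ)]
    split_ifs
    · exact Dvd.intro _ rfl
    · exact dvd_zero _
  rw [DirectSum.coe_decompose_mul_of_left_mem (homogeneousSubmodule (Fin 3) ℝ) e
      ((mem_homogeneousSubmodule _ _).2 hB)] at key
  constructor
  · intro hbe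
    rw [if_pos hbe] at key
    refine ⟨_, (mem_homogeneousSubmodule _ _).1
      (DirectSum.decompose (homogeneousSubmodule (Fin 3) ℝ) g (e - b)).2, ?_⟩
    rw [sub_eq_of_eq_add' key]
    exact hl2
  · intro hbe
    rw [if_neg (by omega), zero_add] at key
    rw [key]; exact hl2

lemma assemble (f ℓ B : S) (m : ℕ) (T : Derivation ℝ S S →ₗ[S] S)
    (hT : ∀ θ d, IsHomogDer θ d → (T θ).IsHomogeneous (d + 1))
    (hℓ : ℓ.IsHomogeneous 1) (hB : B.IsHomogeneous (m + 1))
    (h1 : ∀ θ ∈ D0 f, ∃ g, ℓ ∣ T θ - B * g)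
    (h2 : ∀ p, ℓ ∣ B * p → ℓ ∣ p)
    (h3 : ∃ θ ∈ D0 f, (T θ).IsHomogeneous (m + 1) ∧ ¬ ℓ ∣ T θ) :
    ∃ ψ : D0 f →ₗ[S] S ⧸ Ideal.span {ℓ},
      Function.Surjective ψ ∧
      (∀ d : ℕ, m ≤ d → ∀ θ : D0 f,
        IsHomogDer (θ : Derivation ℝ S S) d →
          ∃ g : S, g.IsHomogeneous (d - m) ∧
            ψ θ = Ideal.Quotient.mk (Ideal.span {ℓ}) g) ∧
      (∀ d : ℕ, d < m → ∀ θ : D0 f,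
        IsHomogDer (θ : Derivation ℝ S S) d → ψ θ = 0) := by
  choose g hg using h1
  have hmk : ∀ p q : S, Ideal.Quotient.mk (Ideal.span {ℓ}) p = Ideal.Quotient.mk (Ideal.span {ℓ}) q
      ↔ ℓ ∣ p - q := by
    intro p q
    rw [Ideal.Quotient.eq, Ideal.mem_span_singleton]
  have uniq : ∀ (θ) (hθ : θ ∈ D0 f) (p : S), ℓ ∣ T θ - B * p →
      Ideal.Quotient.mk (Ideal.span {ℓ}) (g θ hθ) = Ideal.Quotient.mk (Ideal.span {ℓ}) p := by
    intro θ hθ p hp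
    rw [hmk]
    apply h2
    have := dvd_sub hp (hg θ hθ)
    convert this using 1; ring
  let ψ : D0 f →ₗ[S] S ⧸ Ideal.span {ℓ} :=
    { toFun := fun θ => Ideal.Quotient.mk (Ideal.span {ℓ}) (g θ.1 θ.2)
      map_add' := by
        intro a b
        rw [← map_add]
        apply uniq
        have := dvd_add (hg a.1 a.2) (hg b.1 b.2)
        convert this using 1
        simp only [Submodule.coe_add, map_add]; ring
      map_smul' := by
        intro c a
        have : (RingHom.id S) c • Ideal.Quotient.mk (Ideal.span {ℓ}) (g a.1 a.2)
          = Ideal.Quotient.mk (Ideal.span {ℓ}) (c * g a.1 a.2) := by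
          rfl
        rw [this]
        apply uniq
        have := Dvd.dvd.mul_left (hg a.1 a.2) c
        convert this using 1
        simp only [Submodule.coe_smul, map_smul, smul_eq_mul]; ring }
  refine ⟨ψ, ?_, ?_, ?_⟩
  · obtain ⟨θ, hθ, hh, hn⟩ := h3
    obtain ⟨g', hg', hd⟩ := (grade_extract ℓ B (T θ) _ _ _ hℓ hB hh (hg θ hθ)).1 le_rfl
    rw [Nat.sub_self] at hg'
    have hgc : g' = C (coeff 0 g') := by
      apply totalDegree_eq_zero_iff_eq_C.1
      have := hg'.totalDegree_le
      omega
    have hc : coeff 0 g' ≠ 0 := by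
      intro h0
      rw [h0, map_zero] at hgc
      apply hn
      simpa [hgc] using hd
    intro q
    obtain ⟨p, rfl⟩ := Ideal.Quotient.mk_surjective q
    refine ⟨(C (coeff 0 g')⁻¹ * p) • ⟨θ, hθ⟩, ?_⟩
    rw [map_smul]
    have : ψ ⟨θ, hθ⟩ = Ideal.Quotient.mk (Ideal.span {ℓ}) g' := uniq θ hθ g' hd
    rw [this]
    have hsm : ∀ c q : S, c • Ideal.Quotient.mk (Ideal.span {ℓ}) q
      = Ideal.Quotient.mk (Ideal.span {ℓ}) (c * q) := fun _ _ => rfl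
    rw [hsm]
    congr 1
    conv_lhs => rw [hgc]
    have : (C (coeff 0 g')⁻¹ : S) * C (coeff 0 g') = 1 := by
      rw [← C_mul, inv_mul_cancel₀ hc, C_1]
    simp only [coeff_C, if_true]
    linear_combination p * this
  · intro d hd θ hθ
    obtain ⟨g', hg', hd'⟩ := (grade_extract ℓ B (T θ) _ _ _ hℓ hB (hT _ _ hθ) (hg θ.1 θ.2)).1
      (by omega)
    refine ⟨g', ?_, uniq _ _ _ hd'⟩
    convert hg' using 1; omega
  · intro d hd θ hθ
    have := (grade_extract ℓ B (T θ) _ _ _ hℓ hB (hT _ _ hθ) (hg θ.1 θ.2)).2 (by omega)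
    have h := uniq θ.1 θ.2 0 (by simpa using this)
    rw [map_zero] at h
    exact h

/-- The linear map `θ ↦ z θ(γ) - γ θ(z)`. -/
def Tmap (γ : S) : Derivation ℝ S S →ₗ[S] S where
  toFun θ := X 2 * θ γ - γ * θ (X 2)
  map_add' a b := by simp only [Derivation.add_apply]; ring
  map_smul' c a := by simp only [Derivation.smul_apply, smul_eq_mul, RingHom.id_apply]; ring

lemma Tmap_apply (γ : S) (θ : Derivation ℝ S S) : Tmap γ θ = X 2 * θ γ - γ * θ (X 2) := rfl


lemma linear_irred (L : S) (hL : L.IsHomogeneous 1) (h0 : L ≠ 0) : Irreducible L := by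
  apply irreducible_of_totalDegree_eq_one (hL.totalDegree h0)
  intro x hx
  by_contra hu
  have hx0 : x = 0 := by
    by_contra h; exact hu (isUnit_iff_ne_zero.2 h)
  apply h0
  ext i
  simpa [hx0] using hx i

lemma log_of_kill (f L h : S) (θ : Derivation ℝ S S) (hθ : θ f = 0) (hf : f = L * h)
    (hL : L.IsHomogeneous 1) (p : Fin 3 → ℝ) (hp : eval p L = 0) (hh : eval p h ≠ 0) :
    L ∣ θ L := by
  rcases eq_or_ne L 0 with rfl | h0
  · simp
  have hpr : Prime L := (linear_irred L hL h0).prime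
  have h1 : L ∣ h * θ L := by
    refine ⟨- θ h, ?_⟩
    rw [hf, Derivation.leibniz] at hθ
    simp only [smul_eq_mul] at hθ
    linear_combination hθ
  rcases hpr.dvd_or_dvd h1 with h2 | h2
  · exfalso
    obtain ⟨q, rfl⟩ := h2
    simp [hp] at hh
  · exact h2

/-- `α - s z`. -/
def lin (α : S) (s : ℝ) : S := α - C s * X 2

lemma lin_hom (α : S) (hα : α.IsHomogeneous 1) (s : ℝ) : (lin α s).IsHomogeneous 1 := by
  apply hα.sub
  simpa using (isHomogeneous_C (Fin 3) s).mul (isHomogeneous_X ℝ (2 : Fin 3))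

/-- `P(α) = ∏ (α - s z)`. -/
def PP (j k : ℕ) (α : S) : S := ∏ s ∈ Finset.Icc (-(j : ℤ)) ((k : ℤ) + j), lin α (s : ℝ)

lemma PP_hom (j k : ℕ) (α : S) (hα : α.IsHomogeneous 1) :
    (PP j k α).IsHomogeneous (k + 2 * j + 1) := by
  have := IsHomogeneous.prod (Finset.Icc (-(j : ℤ)) ((k : ℤ) + j)) (fun s : ℤ => lin α (s : ℝ))
    (fun _ => 1) (fun i _ => lin_hom α hα _)
  have e : (∑ i ∈ Finset.Icc (-(j : ℤ)) ((k : ℤ) + j), 1) = k + 2 * j + 1 := by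
    rw [Finset.sum_const, Int.card_Icc, smul_eq_mul]
    omega
  rw [e] at this
  exact this

lemma fjk_eq (j k : ℕ) : fjk j k = X 2 * (PP j k (X 0) * PP j k (X 1) * PP j k (X 0 + X 1)) := by
  simp only [fjk, PP, lin, Finset.prod_mul_distrib]

lemma fjk_hom (j k : ℕ) : (fjk j k).IsHomogeneous (1 + ((k + 2 * j + 1) + (k + 2 * j + 1) + (k + 2 * j + 1))) := by
  rw [fjk_eq]
  have h0 := isHomogeneous_X ℝ (0 : Fin 3)
  have h1 := isHomogeneous_X ℝ (1 : Fin 3)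
  have h2 := isHomogeneous_X ℝ (2 : Fin 3)
  exact h2.mul (((PP_hom j k _ h0).mul (PP_hom j k _ h1)).mul (PP_hom j k _ (h0.add h1)))

/-- Logarithmic along the family `α`. -/
def LogAlong (j k : ℕ) (θ : Derivation ℝ S S) (α : S) : Prop :=
  ∀ s ∈ Finset.Icc (-(j : ℤ)) ((k : ℤ) + j), lin α (s : ℝ) ∣ θ (lin α (s : ℝ))

lemma half_ne (s : ℤ) : (1 / 2 : ℝ) ≠ s := by
  intro h
  have h2 : (1 : ℝ) = ((2 * s : ℤ) : ℝ) := by push_cast; linarith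
  have h3 : (1 : ℤ) = 2 * s := by exact_mod_cast h2
  omega

lemma eval_lin (p : Fin 3 → ℝ) (α : S) (s : ℝ) : eval p (lin α s) = eval p α - s * p 2 := by
  simp [lin]

lemma eval_PP_ne (j k : ℕ) (p : Fin 3 → ℝ) (α : S)
    (h : ∀ s : ℤ, eval p α - s * p 2 ≠ 0) : eval p (PP j k α) ≠ 0 := by
  rw [PP, map_prod]
  apply Finset.prod_ne_zero_iff.2
  intro s _
  rw [eval_lin]
  exact h s

lemma log_family (j k : ℕ) (f α h : S) (hα : α.IsHomogeneous 1) (θ : Derivation ℝ S S)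
    (hθ : θ f = 0) (hf : f = PP j k α * h)
    (hp : ∀ s : ℤ, ∃ p : Fin 3 → ℝ, p 2 = 1 ∧ eval p α = s ∧ eval p h ≠ 0) :
    LogAlong j k θ α := by
  intro s hs
  obtain ⟨p, hp2, hps, hph⟩ := hp s
  refine log_of_kill f _ ((∏ r ∈ (Finset.Icc (-(j : ℤ)) ((k : ℤ) + j)).erase s, lin α (r : ℝ)) * h)
    θ hθ ?_ (lin_hom α hα _) p ?_ ?_
  · rw [hf, PP, ← Finset.mul_prod_erase _ _ hs, mul_assoc]
  · rw [eval_lin, hp2, hps]; ring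
  · rw [map_mul, map_prod]
    apply mul_ne_zero _ hph
    apply Finset.prod_ne_zero_iff.2
    intro r hr
    rw [eval_lin, hp2, hps, mul_one, sub_ne_zero]
    exact_mod_cast (Finset.ne_of_mem_erase hr).symm

lemma log_all (j k : ℕ) (θ : Derivation ℝ S S) (hθ : θ ∈ D0 (fjk j k)) :
    X 2 ∣ θ (X 2) ∧ LogAlong j k θ (X 0) ∧ LogAlong j k θ (X 1) ∧ LogAlong j k θ (X 0 + X 1) := by
  have hθ' : θ (fjk j k) = 0 := hθ
  have h0 := isHomogeneous_X ℝ (0 : Fin 3)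
  have h1 := isHomogeneous_X ℝ (1 : Fin 3)
  have h2 := isHomogeneous_X ℝ (2 : Fin 3)
  have hint : ∀ a b : ℤ, (a : ℝ) - 1 / 2 - b ≠ 0 := by
    intro a b h
    apply half_ne (a - b)
    push_cast; linarith
  have hint' : ∀ a b : ℤ, (a : ℝ) + 1 / 2 - b ≠ 0 := by
    intro a b h
    apply half_ne (b - a)
    push_cast; linarith
  refine ⟨?_, ?_, ?_, ?_⟩
  · refine log_of_kill _ _ _ θ hθ' (fjk_eq j k) h2 ![1, 1, 0] (by simp) ?_
    simp only [map_mul]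
    refine mul_ne_zero (mul_ne_zero ?_ ?_) ?_ <;> apply eval_PP_ne <;> intro s <;> simp
  · refine log_family j k _ (X 0) (X 2 * (PP j k (X 1) * PP j k (X 0 + X 1))) h0 θ hθ'
      (by rw [fjk_eq]; ring) ?_
    intro s
    refine ⟨![s, 1 / 2, 1], by simp, by simp, ?_⟩
    simp only [map_mul]
    refine mul_ne_zero (by simp) (mul_ne_zero ?_ ?_) <;> apply eval_PP_ne <;> intro r
    · simpa using hint' 0 r
    · simpa using hint' s r
  · refine log_family j k _ (X 1) (X 2 * (PP j k (X 0) * PP j k (X 0 + X 1))) h1 θ hθ'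
      (by rw [fjk_eq]; ring) ?_
    intro s
    refine ⟨![1 / 2, s, 1], by simp, by simp, ?_⟩
    simp only [map_mul]
    refine mul_ne_zero (by simp) (mul_ne_zero ?_ ?_) <;> apply eval_PP_ne <;> intro r
    · simpa using hint' 0 r
    · simpa [add_comm] using hint' s r
  · refine log_family j k _ (X 0 + X 1) (X 2 * (PP j k (X 0) * PP j k (X 1))) (h0.add h1) θ hθ'
      (by rw [fjk_eq]; ring) ?_
    intro s
    refine ⟨![1 / 2, s - 1 / 2, 1], by simp, by simp, ?_⟩
    simp only [map_mul]
    refine mul_ne_zero (by simp) (mul_ne_zero ?_ ?_) <;> apply eval_PP_ne <;> intro r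
    · simpa using hint' 0 r
    · simpa using hint s r

lemma dvd_der_mul (θ : Derivation ℝ S S) (a b : S) (ha : a ∣ θ a) (hb : b ∣ θ b) :
    a * b ∣ θ (a * b) := by
  obtain ⟨p, hp⟩ := ha
  obtain ⟨q, hq⟩ := hb
  refine ⟨p + q, ?_⟩
  rw [Derivation.leibniz, hp, hq]
  simp only [smul_eq_mul]; ring

lemma dvd_der_PP (j k : ℕ) (θ : Derivation ℝ S S) (α : S) (h : LogAlong j k θ α) :
    PP j k α ∣ θ (PP j k α) := by
  rw [PP]
  suffices H : ∀ F : Finset ℤ, F ⊆ Finset.Icc (-(j : ℤ)) ((k : ℤ) + j) →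
      (∏ s ∈ F, lin α (s : ℝ)) ∣ θ (∏ s ∈ F, lin α (s : ℝ)) from H _ subset_rfl
  intro F
  induction F using Finset.induction_on with
  | empty => intro _; simp
  | insert a F ha ih =>
    intro hF
    rw [Finset.prod_insert ha]
    exact dvd_der_mul _ _ _ (h a (hF (Finset.mem_insert_self _ _)))
      (ih fun x hx => hF (Finset.mem_insert_of_mem hx))
 
/-- Euler derivation. -/
def Eul : Derivation ℝ S S := (X 0 : S) • pderiv 0 + (X 1 : S) • pderiv 1 + (X 2 : S) • pderiv 2

lemma Eul_apply (f : S) (n : ℕ) (h : f.IsHomogeneous n) : Eul f = n • f := by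
  rw [← h.sum_X_mul_pderiv, Eul, Fin.sum_univ_three]
  simp

lemma exists_D0 (j k : ℕ) (θ : Derivation ℝ S S) (hz : X 2 ∣ θ (X 2))
    (h0 : LogAlong j k θ (X 0)) (h1 : LogAlong j k θ (X 1)) (h01 : LogAlong j k θ (X 0 + X 1)) :
    ∃ q : S, θ - q • Eul ∈ D0 (fjk j k) := by
  have : fjk j k ∣ θ (fjk j k) := by
    rw [fjk_eq]
    exact dvd_der_mul _ _ _ hz (dvd_der_mul _ _ _ (dvd_der_mul _ _ _ (dvd_der_PP j k θ _ h0)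
      (dvd_der_PP j k θ _ h1)) (dvd_der_PP j k θ _ h01))
  obtain ⟨g, hg⟩ := this
  set m := (1 + ((k + 2 * j + 1) + (k + 2 * j + 1) + (k + 2 * j + 1))) with hm
  refine ⟨C ((m : ℝ)⁻¹) * g, ?_⟩
  change (θ - _) (fjk j k) = 0
  rw [Derivation.sub_apply, Derivation.smul_apply, Eul_apply _ _ (fjk_hom j k), hg, ← hm]
  have : (C ((m : ℝ)⁻¹) : S) * (m : S) = 1 := by
    rw [← C_eq_coe_nat, ← C_mul, inv_mul_cancel₀ (by rw [hm]; positivity), C_1]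
  simp only [smul_eq_mul, nsmul_eq_mul]
  linear_combination - fjk j k * g * this


lemma descFac_prod (p i : ℕ) : (p.descFactorial i : ℝ) = ∏ s ∈ Finset.range i, ((p : ℝ) - s) := by
  induction i with
  | zero => simp
  | succ i ih =>
    rw [Finset.prod_range_succ, ← ih, Nat.descFactorial_succ]
    rcases le_or_gt i p with h | h
    · push_cast [h]; ring
    · rw [Nat.descFactorial_eq_zero_iff_lt.2 h]; simp

lemma descFac_ratio (M x i : ℕ) :
    ((M - x).descFactorial i : ℝ) * M.descFactorial x
      = (M - i).descFactorial x * M.descFactorial i := by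
  have h1 := Nat.descFactorial_mul_descFactorial (n := M) (Nat.le_add_right x i)
  have h2 := Nat.descFactorial_mul_descFactorial (n := M) (Nat.le_add_left i x)
  rw [Nat.add_sub_cancel_left] at h1
  rw [Nat.add_sub_cancel] at h2
  exact_mod_cast h1.trans h2.symm

/-- The coefficients of the explicit syzygy. -/
def coef (j k i : ℕ) : ℝ :=
  (-1) ^ i * j.choose i / ((k + 2 * j).descFactorial i * (k + 2 * j).descFactorial (k + j - i))

lemma alt_sum (j : ℕ) (Q : Polynomial ℝ) (hQ : Q.natDegree < j) :
    ∑ i ∈ Finset.range (j + 1), (-1) ^ i * (j.choose i : ℝ) * Q.eval (i : ℝ) = 0 := by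
  have h := congrFun (Polynomial.fwdDiff_iter_eq_zero_of_degree_lt hQ) 0
  rw [fwdDiff_iter_eq_sum_shift] at h
  have h' : (-1 : ℝ) ^ j * ∑ i ∈ Finset.range (j + 1), (-1) ^ i * (j.choose i : ℝ) * Q.eval (i : ℝ)
      = 0 := by
    rw [Finset.mul_sum]
    rw [Pi.zero_apply] at h
    rw [← h]
    apply Finset.sum_congr rfl
    intro i hi
    have hij : i ≤ j := by simpa [Nat.lt_succ_iff] using hi
    obtain ⟨r, rfl⟩ := Nat.exists_eq_add_of_le hij
    simp only [zsmul_eq_mul]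
    push_cast
    rw [Nat.add_sub_cancel_left]
    have : ((-1 : ℝ) ^ i) * (-1) ^ i = 1 := by rw [← mul_pow]; simp
    simp only [zero_add, nsmul_eq_mul, mul_one, pow_add]
    linear_combination ((-1) ^ r * ((i + r).choose i : ℝ) * Q.eval (i : ℝ)) * this
  exact (mul_eq_zero.1 h').resolve_left (by positivity)

lemma coef_sum_zero (j k p q : ℕ) (hp : p ≤ k + 2 * j) (hq : q ≤ k + 2 * j)
    (h : p + q < k + j ∨ 2 * k + 3 * j < p + q) :
    ∑ i ∈ Finset.range (j + 1),
      coef j k i * ((p.descFactorial i : ℝ) * (q.descFactorial (k + j - i) : ℝ)) = 0 := by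
  rcases h with h | h
  · apply Finset.sum_eq_zero
    intro i hi
    rcases lt_or_ge p i with h1 | h1
    · rw [Nat.descFactorial_eq_zero_iff_lt.2 h1]; simp
    · rw [Nat.descFactorial_eq_zero_iff_lt.2 (show q < k + j - i by omega)]; simp
  · obtain ⟨x, hx⟩ := Nat.exists_eq_add_of_le hp
    obtain ⟨y, hy⟩ := Nat.exists_eq_add_of_le hq
    have hxp : p = k + 2 * j - x := by omega
    have hyq : q = k + 2 * j - y := by omega
    set M := k + 2 * j with hM
    let Q : Polynomial ℝ := (∏ s ∈ Finset.range x, (Polynomial.C ((M : ℝ) - s) - Polynomial.X)) *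
      (∏ s ∈ Finset.range y, (Polynomial.X + Polynomial.C ((j : ℝ) - s)))
    have hQ : Q.natDegree < j := by
      refine lt_of_le_of_lt (Polynomial.natDegree_mul_le_of_le (m := x) (n := y) ?_ ?_) (by omega)
      · refine (Polynomial.natDegree_prod_le _ _).trans ?_
        refine (Finset.sum_le_card_nsmul _ _ 1 ?_).trans (by simp)
        intro s _
        compute_degree
      · refine (Polynomial.natDegree_prod_le _ _).trans ?_
        refine (Finset.sum_le_card_nsmul _ _ 1 ?_).trans (by simp)
        intro s _
        compute_degree
    have hz := alt_sum j Q hQ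
    have hMx : (M.descFactorial x : ℝ) ≠ 0 := by
      rw [Nat.cast_ne_zero, Ne, Nat.descFactorial_eq_zero_iff_lt]; omega
    have hMy : (M.descFactorial y : ℝ) ≠ 0 := by
      rw [Nat.cast_ne_zero, Ne, Nat.descFactorial_eq_zero_iff_lt]; omega
    have : ((M.descFactorial x : ℝ) * M.descFactorial y) * ∑ i ∈ Finset.range (j + 1),
      coef j k i * ((p.descFactorial i : ℝ) * (q.descFactorial (k + j - i) : ℝ)) = 0 := by
      rw [Finset.mul_sum, ← hz]
      apply Finset.sum_congr rfl
      intro i hi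
      have hij : i ≤ j := by simpa [Nat.lt_succ_iff] using hi
      have hMi : (M.descFactorial i : ℝ) ≠ 0 := by
        rw [Nat.cast_ne_zero, Ne, Nat.descFactorial_eq_zero_iff_lt]; omega
      have hMi' : (M.descFactorial (k + j - i) : ℝ) ≠ 0 := by
        rw [Nat.cast_ne_zero, Ne, Nat.descFactorial_eq_zero_iff_lt]; omega
      have e1 := descFac_ratio M x i
      have e2 := descFac_ratio M y (k + j - i)
      rw [← hxp] at e1
      rw [← hyq] at e2
      have e3 : Q.eval (i : ℝ) = ((M - i).descFactorial x : ℝ) *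
          ((M - (k + j - i)).descFactorial y : ℝ) := by
        rw [descFac_prod, descFac_prod]
        simp only [Q, Polynomial.eval_mul, Polynomial.eval_prod, Polynomial.eval_sub,
          Polynomial.eval_add, Polynomial.eval_C, Polynomial.eval_X]
        have a1 : ((M - i : ℕ) : ℝ) = M - i := by
          rw [Nat.cast_sub (by omega)]
        have a2 : ((M - (k + j - i) : ℕ) : ℝ) = j + i := by
          have : M - (k + j - i) = j + i := by omega
          rw [this]; push_cast; ring
        rw [a1, a2]
        congr 1
        · apply Finset.prod_congr rfl; intros; ring
        · apply Finset.prod_congr rfl; intros; ring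
      rw [e3, coef, ← hM]
      have e4 : ((M.descFactorial x : ℝ) * M.descFactorial y) *
        ((p.descFactorial i : ℝ) * (q.descFactorial (k + j - i) : ℝ)) =
        (((M - i).descFactorial x : ℝ) * ((M - (k + j - i)).descFactorial y : ℝ)) *
          (M.descFactorial i * M.descFactorial (k + j - i)) := by
        calc _ = ((p.descFactorial i : ℝ) * M.descFactorial x) *
              ((q.descFactorial (k + j - i) : ℝ) * M.descFactorial y) := by ring
          _ = _ := by rw [e1, e2]; ring
      field_simp
      linear_combination (j.choose i : ℝ) * e4
    exact (mul_eq_zero.1 this).resolve_left (mul_ne_zero hMx hMy)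

section generic
variable {A : Type*} [CommRing A] [Algebra ℝ A]

def FF (j k i : ℕ) (α z : A) : A :=
  ∏ s ∈ Finset.range i, (algebraMap ℝ A ((k : ℝ) + j - s) * z - α)

def WW (j k : ℕ) (α β z : A) : A :=
  ∑ i ∈ Finset.range (j + 1),
    algebraMap ℝ A (coef j k i) * (FF j k i α z * FF j k (k + j - i) β z)

def PA (j k : ℕ) (α z : A) : A :=
  ∏ s ∈ Finset.Icc (-(j : ℤ)) ((k : ℤ) + j), (α - algebraMap ℝ A (s : ℝ) * z)

lemma FF_map {A' : Type*} [CommRing A'] [Algebra ℝ A'] (φ : A →ₐ[ℝ] A') (j k i : ℕ) (α z : A) :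
    φ (FF j k i α z) = FF j k i (φ α) (φ z) := by
  simp only [FF, map_prod, map_sub, map_mul, AlgHom.commutes]

lemma WW_map {A' : Type*} [CommRing A'] [Algebra ℝ A'] (φ : A →ₐ[ℝ] A') (j k : ℕ) (α β z : A) :
    φ (WW j k α β z) = WW j k (φ α) (φ β) (φ z) := by
  simp only [WW, map_sum, map_mul, AlgHom.commutes, FF_map]

lemma PA_map {A' : Type*} [CommRing A'] [Algebra ℝ A'] (φ : A →ₐ[ℝ] A') (j k : ℕ) (α z : A) :
    φ (PA j k α z) = PA j k (φ α) (φ z) := by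
  simp only [PA, map_prod, map_sub, map_mul, AlgHom.commutes]

lemma FF_grid (j k i p : ℕ) (z : A) :
    FF j k i (algebraMap ℝ A ((k : ℝ) + j - p) * z) z
      = algebraMap ℝ A (p.descFactorial i : ℝ) * z ^ i := by
  rw [FF, descFac_prod, map_prod]
  have : (z ^ i) = ∏ s ∈ Finset.range i, z := by simp
  rw [this, ← Finset.prod_mul_distrib]
  apply Finset.prod_congr rfl
  intro s _
  rw [← sub_mul, ← map_sub]
  congr 2
  ring

lemma WW_grid (j k p q : ℕ) (hp : p ≤ k + 2 * j) (hq : q ≤ k + 2 * j)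
    (h : p + q < k + j ∨ 2 * k + 3 * j < p + q) (z : A) :
    WW j k (algebraMap ℝ A ((k : ℝ) + j - p) * z) (algebraMap ℝ A ((k : ℝ) + j - q) * z) z = 0 := by
  have := coef_sum_zero j k p q hp hq h
  have h2 := congrArg (fun r => algebraMap ℝ A r * z ^ (k + j)) this
  simp only [map_sum, map_zero, zero_mul, Finset.sum_mul] at h2
  rw [WW, ← h2]
  apply Finset.sum_congr rfl
  intro i hi
  have hij : i ≤ j := by simpa [Nat.lt_succ_iff] using hi
  rw [FF_grid, FF_grid, map_mul, map_mul]
  have : z ^ (k + j) = z ^ i * z ^ (k + j - i) := by rw [← pow_add]; congr 1; omega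
  rw [this]; ring

lemma WP_grid (j k : ℕ) (a b : ℤ) (ha : a ∈ Finset.Icc (-(j : ℤ)) ((k : ℤ) + j))
    (hb : b ∈ Finset.Icc (-(j : ℤ)) ((k : ℤ) + j)) (z : A) :
    WW j k (algebraMap ℝ A (a : ℝ) * z) (algebraMap ℝ A (b : ℝ) * z) z *
      PA j k (algebraMap ℝ A (k : ℝ) * z - algebraMap ℝ A (a : ℝ) * z - algebraMap ℝ A (b : ℝ) * z) z
      = 0 := by
  rw [Finset.mem_Icc] at ha hb
  by_cases hc : (k : ℤ) - a - b ∈ Finset.Icc (-(j : ℤ)) ((k : ℤ) + j)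
  · have : PA j k (algebraMap ℝ A (k : ℝ) * z - algebraMap ℝ A (a : ℝ) * z
        - algebraMap ℝ A (b : ℝ) * z) z = 0 := by
      apply Finset.prod_eq_zero hc
      rw [Int.cast_sub, Int.cast_sub, Int.cast_natCast, map_sub, map_sub]
      ring
    rw [this, mul_zero]
  · rw [Finset.mem_Icc] at hc
    obtain ⟨p, hp⟩ := Int.eq_ofNat_of_zero_le (show 0 ≤ (k : ℤ) + j - a by omega)
    obtain ⟨q, hq⟩ := Int.eq_ofNat_of_zero_le (show 0 ≤ (k : ℤ) + j - b by omega)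
    have ea : (a : ℝ) = (k : ℝ) + j - p := by
      have : a = (k : ℤ) + j - p := by omega
      rw [this]; push_cast; ring
    have eb : (b : ℝ) = (k : ℝ) + j - q := by
      have : b = (k : ℤ) + j - q := by omega
      rw [this]; push_cast; ring
    rw [ea, eb, WW_grid j k p q (by omega) (by omega) (by omega), zero_mul]

lemma hphi (j k : ℕ) (z : A) (x : Fin 2 → A) :
    (aeval x : MvPolynomial (Fin 2) A →ₐ[A] A)
      (WW j k (X 0 : MvPolynomial (Fin 2) A) (X 1) (C z) *
        PA j k (C (algebraMap ℝ A (k : ℝ)) * C z - X 0 - X 1) (C z)) =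
      WW j k (x 0) (x 1) z * PA j k (algebraMap ℝ A (k : ℝ) * z - x 0 - x 1) z := by
  have h1 := WW_map ((aeval x : MvPolynomial (Fin 2) A →ₐ[A] A).restrictScalars ℝ) j k
    (X 0) (X 1) (C z)
  have h2 := PA_map ((aeval x : MvPolynomial (Fin 2) A →ₐ[A] A).restrictScalars ℝ) j k
    (C (algebraMap ℝ A (k : ℝ)) * C z - X 0 - X 1) (C z)
  simp only [map_sub, map_mul, AlgHom.restrictScalars_apply, aeval_X, aeval_C,
    Algebra.algebraMap_self, RingHom.id_apply] at h1 h2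
  rw [map_mul, h1, h2]

lemma syz_generic [IsDomain A] (j k : ℕ) (z α β : A) (hz : z ≠ 0) :
    ∃ u v : A, WW j k α β z * PA j k (algebraMap ℝ A (k : ℝ) * z - α - β) z
      = u * PA j k α z + v * PA j k β z := by
  classical
  have hinj : Function.Injective (fun s : ℤ => (algebraMap ℝ A (s : ℝ) * z)) := by
    intro s t h
    have h1 := mul_right_cancel₀ hz h
    have h2 := (algebraMap ℝ A).injective h1
    exact_mod_cast h2
  obtain ⟨h, -, hF⟩ := combinatorial_nullstellensatz_exists_linearCombination
    (fun _ : Fin 2 => (Finset.Icc (-(j : ℤ)) ((k : ℤ) + j)).image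
      (fun s : ℤ => algebraMap ℝ A (s : ℝ) * z)) (fun _ => by
      refine Finset.Nonempty.image ⟨0, ?_⟩ _
      rw [Finset.mem_Icc]; omega)
      (WW j k (X 0 : MvPolynomial (Fin 2) A) (X 1) (C z) *
        PA j k (C (algebraMap ℝ A (k : ℝ)) * C z - X 0 - X 1) (C z)) (by
      intro x hx
      have h0 := hx 0
      have h1 := hx 1
      rw [Finset.mem_image] at h0 h1
      obtain ⟨a, ha, h0⟩ := h0
      obtain ⟨b, hb, h1⟩ := h1
      have := hphi j k z x
      rw [← h0, ← h1] at this
      rw [← coe_aeval_eq_eval]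
      exact this.trans (WP_grid j k a b ha hb z))
  have key := congrArg (aeval ![α, β] : MvPolynomial (Fin 2) A →ₐ[A] A) hF
  rw [hphi, Finsupp.linearCombination_apply, Finsupp.sum_fintype _ _ (by simp),
    Fin.sum_univ_two] at key
  simp only [Finset.prod_image hinj.injOn, smul_eq_mul, map_add, map_mul, map_prod, map_sub,
    aeval_X, aeval_C, Algebra.algebraMap_self, RingHom.id_apply] at key
  exact ⟨_, _, key⟩

end generic

lemma PA_eq (j k : ℕ) (α : S) : PA j k α (X 2) = PP j k α := rfl

lemma syz_exists (j k : ℕ) (α β γ : S) (hs : α + β + γ = C (k : ℝ) * X 2) :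
    ∃ u v : S, WW j k α β (X 2) * PP j k γ = u * PP j k α + v * PP j k β := by
  obtain ⟨u, v, h⟩ := syz_generic j k (X 2 : S) α β (X_ne_zero _)
  have e : γ = algebraMap ℝ S (k : ℝ) * X 2 - α - β := by
    rw [MvPolynomial.algebraMap_eq, ← hs]; ring
  rw [e]
  exact ⟨u, v, h⟩


structure IsTriple (j k : ℕ) (α β γ : S) : Prop where
  hs : α + β + γ = C (k : ℝ) * X 2
  ha : α.IsHomogeneous 1
  hb : β.IsHomogeneous 1
  hc : γ.IsHomogeneous 1
  hlog : ∀ θ ∈ D0 (fjk j k), LogAlong j k θ α ∧ LogAlong j k θ β ∧ LogAlong j k θ γ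
  hlog' : ∀ θ, X 2 ∣ θ (X 2) → LogAlong j k θ α → LogAlong j k θ β → LogAlong j k θ γ →
    ∃ q : S, θ - q • Eul ∈ D0 (fjk j k)
  hder : ∀ a b : S, ∃ θ : Derivation ℝ S S, θ (X 2) = 0 ∧ θ α = a ∧ θ β = b
  hrel : IsRelPrime γ (X 2)
  hcd : ∀ θ d, IsHomogDer θ d → (θ γ).IsHomogeneous d

lemma lin_der (θ : Derivation ℝ S S) (α : S) (s : ℝ) : θ (lin α s) = θ α - C s * θ (X 2) := by
  simp [lin, Derivation.leibniz, C_mul']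

lemma Tmap_dvd (θ : Derivation ℝ S S) (α : S) (s : ℝ) (h : lin α s ∣ θ (lin α s)) :
    lin α s ∣ Tmap α θ := by
  have : Tmap α θ = X 2 * θ (lin α s) - lin α s * θ (X 2) := by
    rw [Tmap_apply, lin_der, lin]; ring
  rw [this]
  exact dvd_sub (Dvd.dvd.mul_left h _) (Dvd.intro _ rfl)

lemma Tmap_dvd_z (θ : Derivation ℝ S S) (α : S) (h : X 2 ∣ θ (X 2)) : X 2 ∣ Tmap α θ := by
  rw [Tmap_apply]
  exact dvd_sub (Dvd.intro _ rfl) (Dvd.dvd.mul_left h _)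

lemma Tmap_sum (k : ℕ) (α β γ : S) (hs : α + β + γ = C (k : ℝ) * X 2) (θ : Derivation ℝ S S) :
    Tmap γ θ = - (Tmap α θ + Tmap β θ) := by
  have e : θ α + θ β + θ γ = C (k : ℝ) * θ (X 2) := by
    rw [← map_add, ← map_add, hs]
    simp [Derivation.leibniz, C_mul']
  simp only [Tmap_apply]
  linear_combination X 2 * e - θ (X 2) * hs

lemma rel_z (γ : S) (h : IsRelPrime γ (X 2)) (s : ℝ) : IsRelPrime (X 2) (lin γ s) := by
  intro d h1 h2
  refine h ?_ h1
  have := dvd_add h2 (Dvd.dvd.mul_left h1 (C s))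
  simpa [lin] using this

lemma rel_lin (γ : S) (h : IsRelPrime γ (X 2)) (s t : ℝ) (hst : s ≠ t) :
    IsRelPrime (lin γ s) (lin γ t) := by
  intro d h1 h2
  have h3 : d ∣ X 2 := by
    have := Dvd.dvd.mul_left (dvd_sub h2 h1) (C (s - t)⁻¹)
    have e : (C (s - t)⁻¹ : S) * (C s - C t) = 1 := by
      rw [← C_sub, ← C_mul, inv_mul_cancel₀ (sub_ne_zero.2 hst), C_1]
    convert this using 1
    rw [lin, lin]
    linear_combination - X 2 * e
  exact rel_z γ h s h3 h1

lemma rel_X (a b : Fin 3) (h : a ≠ b) : IsRelPrime (X a : S) (X b) := by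
  have := (linear_irred (X a : S) (isHomogeneous_X _ _) (X_ne_zero _))
  rw [this.isRelPrime_iff_not_dvd, X_dvd_X]
  simpa using h

lemma prod_lin_dvd (γ : S) (h : IsRelPrime γ (X 2)) (I : Finset ℤ) (T : S)
    (hT : ∀ s ∈ I, lin γ (s : ℝ) ∣ T) : ∏ s ∈ I, lin γ (s : ℝ) ∣ T := by
  apply Finset.prod_dvd_of_isRelPrime
  · intro s _ t _ hst
    exact rel_lin γ h _ _ (by exact_mod_cast hst)
  · exact hT

lemma zpow_prod_lin_dvd (γ : S) (h : IsRelPrime γ (X 2)) (I : Finset ℤ) (n : ℕ) (T : S)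
    (hz : X 2 ^ n ∣ T)
    (hT : ∀ s ∈ I, lin γ (s : ℝ) ∣ T) : X 2 ^ n * ∏ s ∈ I, lin γ (s : ℝ) ∣ T := by
  apply IsRelPrime.mul_dvd _ hz (prod_lin_dvd γ h I T hT)
  apply IsRelPrime.prod_right
  intro s _
  exact (rel_z γ h _).pow_left

lemma Eul_lin (γ : S) (h : γ.IsHomogeneous 1) : Eul γ = γ := by
  rw [Eul_apply _ _ h, one_smul]

lemma Tmap_Eul (γ : S) (h : γ.IsHomogeneous 1) : Tmap γ Eul = 0 := by
  rw [Tmap_apply, Eul_lin _ h, Eul_lin _ (isHomogeneous_X _ _)]; ring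

lemma logAlong_of_dvd (j k : ℕ) (θ : Derivation ℝ S S) (α : S) (hz : θ (X 2) = 0)
    (h : PP j k α ∣ θ α) : LogAlong j k θ α := by
  intro s hs
  rw [lin_der, hz, mul_zero, sub_zero]
  exact (Finset.dvd_prod_of_mem (fun s : ℤ => lin α (s : ℝ)) hs).trans h

lemma CX_hom (c : ℝ) : (C c * X 2 : S).IsHomogeneous 1 := by
  simpa using (isHomogeneous_C (Fin 3) c).mul (isHomogeneous_X ℝ (2 : Fin 3))

lemma FF_hom (j k i : ℕ) (α : S) (h : α.IsHomogeneous 1) : (FF j k i α (X 2)).IsHomogeneous i := by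
  have h1 : ∀ s ∈ Finset.range i,
      (C ((k : ℝ) + j - (s : ℝ)) * X 2 - α : S).IsHomogeneous 1 := fun s _ => (CX_hom _).sub h
  have := IsHomogeneous.prod (Finset.range i)
    (fun s : ℕ => (C ((k : ℝ) + j - (s : ℝ)) * X 2 - α : S)) (fun _ => 1) h1
  have e : (∑ _s ∈ Finset.range i, 1) = i := by simp
  rw [e] at this
  rw [FF]
  exact this

lemma WW_hom (j k : ℕ) (α β : S) (h : α.IsHomogeneous 1) (h' : β.IsHomogeneous 1) :
    (WW j k α β (X 2)).IsHomogeneous (k + j) := by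
  apply IsHomogeneous.sum
  intro i hi
  have hij : i ≤ j := by simpa [Nat.lt_succ_iff] using hi
  have := (isHomogeneous_C (Fin 3) (coef j k i)).mul
    ((FF_hom j k i α h).mul (FF_hom j k (k + j - i) β h'))
  have e : 0 + (i + (k + j - i)) = k + j := by omega
  rw [e] at this
  exact this

lemma exists_elem {j k : ℕ} {α β γ : S} (t : IsTriple j k α β γ) :
    ∃ θ ∈ D0 (fjk j k), Tmap γ θ = - (X 2 * (WW j k α β (X 2) * PP j k γ)) := by
  obtain ⟨u, v, huv⟩ := syz_exists j k α β γ t.hs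
  obtain ⟨θ, hz, h1, h2⟩ := t.hder (u * PP j k α) (v * PP j k β)
  have h3 : θ γ = - (WW j k α β (X 2) * PP j k γ) := by
    have e : θ α + θ β + θ γ = C (k : ℝ) * θ (X 2) := by
      rw [← map_add, ← map_add, t.hs]
      simp [Derivation.leibniz, C_mul']
    rw [hz, h1, h2] at e
    linear_combination e + huv
  obtain ⟨q, hq⟩ := t.hlog' θ (by rw [hz]; exact dvd_zero _)
    (logAlong_of_dvd j k θ α hz (by rw [h1]; exact Dvd.intro_left _ rfl))
    (logAlong_of_dvd j k θ β hz (by rw [h2]; exact Dvd.intro_left _ rfl))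
    (logAlong_of_dvd j k θ γ hz (by rw [h3]; exact (Dvd.intro_left _ rfl).neg_right))
  refine ⟨_, hq, ?_⟩
  rw [map_sub, map_smul, Tmap_Eul _ t.hc, Tmap_apply, hz, h3, smul_zero]
  ring

/-- The common final step. -/
lemma core {j k : ℕ} {α β γ : S} (t : IsTriple j k α β γ) (ℓ : S) (hℓ : ℓ.IsHomogeneous 1)
    (ρ σ : S →ₐ[ℝ] S) (hρℓ : ρ ℓ = 0) (hσ : ∀ i, ℓ ∣ X i - σ (ρ (X i)))
    (B B0 : S) (hB : B.IsHomogeneous (2 * k + 1 + 3 * j + 1)) (hσB : σ B0 = B) (hρB : ρ B = B0)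
    (hB0 : B0 ≠ 0) (hdvd : ∀ θ ∈ D0 (fjk j k), B0 ∣ ρ (Tmap γ θ))
    (p : S →ₐ[ℝ] ℝ) (hp2 : p (X 2) = 1) (hpℓ : p ℓ = 0)
    (hW : WW j k (p α) (p β) 1 ≠ 0)
    (hP : ∀ s ∈ Finset.Icc (-(j : ℤ)) ((k : ℤ) + j), p γ - (s : ℝ) ≠ 0) :
    ∃ ψ : D0 (fjk j k) →ₗ[S] S ⧸ Ideal.span {ℓ},
      Function.Surjective ψ ∧
      (∀ d : ℕ, 2 * k + 1 + 3 * j ≤ d → ∀ θ : D0 (fjk j k),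
        IsHomogDer (θ : Derivation ℝ S S) d →
          ∃ g : S, g.IsHomogeneous (d - (2 * k + 1 + 3 * j)) ∧
            ψ θ = Ideal.Quotient.mk (Ideal.span {ℓ}) g) ∧
      (∀ d : ℕ, d < 2 * k + 1 + 3 * j → ∀ θ : D0 (fjk j k),
        IsHomogDer (θ : Derivation ℝ S S) d → ψ θ = 0) := by
  have hσ' : ∀ q, ℓ ∣ q - σ (ρ q) := by
    have : (Ideal.Quotient.mkₐ ℝ (Ideal.span {ℓ})) =
        ((Ideal.Quotient.mkₐ ℝ (Ideal.span {ℓ})).comp σ).comp ρ := by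
      apply MvPolynomial.algHom_ext
      intro i
      simp only [AlgHom.comp_apply, Ideal.Quotient.mkₐ_eq_mk]
      rw [Ideal.Quotient.eq, Ideal.mem_span_singleton]
      exact hσ i
    intro q
    have h := congrArg (fun φ : S →ₐ[ℝ] (S ⧸ Ideal.span {ℓ}) => φ q) this
    simp only [AlgHom.comp_apply, Ideal.Quotient.mkₐ_eq_mk] at h
    rwa [Ideal.Quotient.eq, Ideal.mem_span_singleton] at h
  apply assemble (fjk j k) ℓ B (2 * k + 1 + 3 * j) (Tmap γ) _ hℓ hB
  · intro θ hθ
    obtain ⟨g, hg⟩ := hdvd θ hθ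
    refine ⟨σ g, ?_⟩
    have := hσ' (Tmap γ θ)
    rwa [hg, map_mul, hσB] at this
  · intro q hq
    obtain ⟨r, hr⟩ := hq
    have h := congrArg ρ hr
    rw [map_mul, map_mul, hρℓ, zero_mul, hρB] at h
    have h0 : ρ q = 0 := (mul_eq_zero.1 h).resolve_left hB0
    have := hσ' q
    rwa [h0, map_zero, sub_zero] at this
  · obtain ⟨θ, hθ, e⟩ := exists_elem t
    refine ⟨θ, hθ, ?_, ?_⟩
    · rw [e]
      have := (isHomogeneous_X ℝ (2 : Fin 3)).mul ((WW_hom j k α β t.ha t.hb).mul (PP_hom j k γ t.hc))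
      have e : 1 + (k + j + (k + 2 * j + 1)) = 2 * k + 1 + 3 * j + 1 := by ring
      rw [e] at this
      exact this.neg
    · rintro ⟨r, hr⟩
      rw [e] at hr
      have h := congrArg p hr
      rw [map_neg, map_mul, map_mul, map_mul, hpℓ, zero_mul, hp2, one_mul, WW_map, hp2, ← PA_eq,
        PA_map, hp2, neg_eq_zero] at h
      rcases mul_eq_zero.1 h with h | h
      · exact hW h
      · rw [PA, Finset.prod_eq_zero_iff] at h
        obtain ⟨s, hs, h⟩ := h
        apply hP s hs
        simpa using h
  · intro θ d hθ
    rw [Tmap_apply]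
    have h1 := (isHomogeneous_X ℝ (2 : Fin 3)).mul (t.hcd θ d hθ)
    have h2 := t.hc.mul (hθ 2)
    rw [add_comm]
    exact h1.sub h2

lemma WW_A (j k : ℕ) : WW j k ((k : ℝ) + j) (-(1 / 2) - (j : ℝ)) (1 : ℝ) ≠ 0 := by
  rw [WW, Finset.sum_eq_single 0]
  · refine mul_ne_zero ?_ (mul_ne_zero (by simp [FF]) ?_)
    · simp only [coef, Algebra.algebraMap_self, RingHom.id_apply]
      apply div_ne_zero (by simp)
      apply mul_ne_zero (by simp)
      rw [Nat.cast_ne_zero, Ne, Nat.descFactorial_eq_zero_iff_lt]; omega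
    · rw [FF, Finset.prod_ne_zero_iff]
      intro s hs
      have : (s : ℝ) < k + j := by
        have := Finset.mem_range.1 hs
        exact_mod_cast (show s < k + j by omega)
      have hj : (0 : ℝ) ≤ j := by positivity
      simp only [Algebra.algebraMap_self, RingHom.id_apply]
      intro h
      linarith
  · intro i _ hi
    have : FF j k i ((k : ℝ) + j) (1 : ℝ) = 0 := by
      apply Finset.prod_eq_zero (Finset.mem_range.2 (Nat.pos_of_ne_zero hi))
      simp
    rw [this]; ring
  · simp

lemma WW_B (j k : ℕ) : WW j k ((k : ℝ) + j + 1) 0 (1 : ℝ) ≠ 0 := by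
  apply ne_of_gt
  rw [WW]
  apply Finset.sum_pos _ ⟨0, by simp⟩
  intro i hi
  have hij : i ≤ j := by simpa [Nat.lt_succ_iff] using hi
  have h1 : FF j k i ((k : ℝ) + j + 1) (1 : ℝ) = (-1) ^ i * ∏ s ∈ Finset.range i, ((s : ℝ) + 1) := by
    have : ((-1 : ℝ) ^ i) = ∏ s ∈ Finset.range i, (-1 : ℝ) := by simp
    rw [this, ← Finset.prod_mul_distrib, FF]
    apply Finset.prod_congr rfl
    intro s _
    simp only [Algebra.algebraMap_self, RingHom.id_apply]
    ring
  have h2 : 0 < FF j k (k + j - i) (0 : ℝ) (1 : ℝ) := by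
    apply Finset.prod_pos
    intro s hs
    have : (s : ℝ) < k + j := by
      have := Finset.mem_range.1 hs
      exact_mod_cast (show s < k + j by omega)
    simp only [Algebra.algebraMap_self, RingHom.id_apply]
    linarith
  have h3 : (0 : ℝ) < ∏ s ∈ Finset.range i, ((s : ℝ) + 1) :=
    Finset.prod_pos fun s _ => by positivity
  have h4 : (0 : ℝ) < (k + 2 * j).descFactorial i := by
    rw [Nat.cast_pos]; apply Nat.pos_of_ne_zero
    rw [Ne, Nat.descFactorial_eq_zero_iff_lt]; omega
  have h5 : (0 : ℝ) < (k + 2 * j).descFactorial (k + j - i) := by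
    rw [Nat.cast_pos]; apply Nat.pos_of_ne_zero
    rw [Ne, Nat.descFactorial_eq_zero_iff_lt]; omega
  have h6 : (0 : ℝ) < j.choose i := by
    rw [Nat.cast_pos]; exact Nat.choose_pos hij
  rw [h1, coef, Algebra.algebraMap_self, RingHom.id_apply]
  have e : ((-1 : ℝ) ^ i) * (-1) ^ i = 1 := by rw [← mul_pow]; simp
  have : (-1 : ℝ) ^ i * (j.choose i) / ((k + 2 * j).descFactorial i * (k + 2 * j).descFactorial (k + j - i))
      * ((-1) ^ i * (∏ s ∈ Finset.range i, ((s : ℝ) + 1)) * FF j k (k + j - i) (0 : ℝ) (1 : ℝ))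
      = (j.choose i) / ((k + 2 * j).descFactorial i * (k + 2 * j).descFactorial (k + j - i))
      * ((∏ s ∈ Finset.range i, ((s : ℝ) + 1)) * FF j k (k + j - i) (0 : ℝ) (1 : ℝ)) := by
    rw [mul_div_assoc]
    linear_combination ((j.choose i) / ((k + 2 * j).descFactorial i * (k + 2 * j).descFactorial (k + j - i))
      * ((∏ s ∈ Finset.range i, ((s : ℝ) + 1)) * FF j k (k + j - i) (0 : ℝ) (1 : ℝ))) * e
  rw [this]
  positivity


lemma map_lin (φ : S →ₐ[ℝ] S) (h : φ (X 2) = X 2) (α : S) (s : ℝ) :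
    φ (lin α s) = lin (φ α) s := by
  simp [lin, h, algHom_C]

lemma map_zlin (φ : S →ₐ[ℝ] S) (h : φ (X 2) = X 2) (α : S) (n : ℕ) (I : Finset ℤ) :
    φ (X 2 ^ n * ∏ s ∈ I, lin α (s : ℝ)) = X 2 ^ n * ∏ s ∈ I, lin (φ α) (s : ℝ) := by
  rw [map_mul, map_pow, h, map_prod]
  simp only [map_lin φ h]

lemma zlin_hom (α : S) (h : α.IsHomogeneous 1) (n : ℕ) (I : Finset ℤ) (d : ℕ)
    (hd : n + I.card = d) : (X 2 ^ n * ∏ s ∈ I, lin α (s : ℝ)).IsHomogeneous d := by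
  have h1 := IsHomogeneous.prod I (fun s : ℤ => lin α (s : ℝ)) (fun _ => 1)
    (fun i _ => lin_hom α h _)
  have e : (∑ _s ∈ I, 1) = I.card := by simp
  rw [e] at h1
  have h2 := isHomogeneous_X_pow (R := ℝ) (2 : Fin 3) n
  rw [← hd]
  exact h2.mul h1

lemma zlin_ne (n : ℕ) (I : Finset ℤ) :
    (X 2 ^ n * ∏ s ∈ I, lin (X 0) (s : ℝ) : S) ≠ 0 := by
  intro h
  have := congrArg (eval ![1 / 2, 0, 1]) h
  rw [map_mul, map_prod, map_zero, mul_eq_zero, Finset.prod_eq_zero_iff] at this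
  rcases this with h | ⟨s, _, h⟩
  · simp at h
  · rw [eval_lin] at h
    apply half_ne s
    have h' : (1 / 2 : ℝ) - s = 0 := by simpa using h
    linarith

lemma coreA {j k : ℕ} {α β γ : S} (t : IsTriple j k α β γ) (ℓ : S) (hℓ : ℓ.IsHomogeneous 1)
    (ρ σ : S →ₐ[ℝ] S) (hρℓ : ρ ℓ = 0) (hσ : ∀ i, ℓ ∣ X i - σ (ρ (X i)))
    (hρ2 : ρ (X 2) = X 2) (hρα : ρ α = C ((k : ℝ) + j) * X 2)
    (hρβ : ρ β = - X 0 - C (j : ℝ) * X 2) (hργ : ρ γ = X 0)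
    (hσ0 : σ (X 0) = γ) (hσ2 : σ (X 2) = X 2) :
    ∃ ψ : D0 (fjk j k) →ₗ[S] S ⧸ Ideal.span {ℓ},
      Function.Surjective ψ ∧
      (∀ d : ℕ, 2 * k + 1 + 3 * j ≤ d → ∀ θ : D0 (fjk j k),
        IsHomogDer (θ : Derivation ℝ S S) d →
          ∃ g : S, g.IsHomogeneous (d - (2 * k + 1 + 3 * j)) ∧
            ψ θ = Ideal.Quotient.mk (Ideal.span {ℓ}) g) ∧
      (∀ d : ℕ, d < 2 * k + 1 + 3 * j → ∀ θ : D0 (fjk j k),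
        IsHomogDer (θ : Derivation ℝ S S) d → ψ θ = 0) := by
  refine core t ℓ hℓ ρ σ hρℓ hσ
    (X 2 ^ 1 * ∏ s ∈ Finset.Icc (-((k : ℤ) + 2 * j)) ((k : ℤ) + j), lin γ (s : ℝ))
    (X 2 ^ 1 * ∏ s ∈ Finset.Icc (-((k : ℤ) + 2 * j)) ((k : ℤ) + j), lin (X 0) (s : ℝ))
    (zlin_hom γ t.hc _ _ _ ?_) ?_ ?_ (zlin_ne _ _) ?_ ((aeval ![1 / 2, 0, 1]).comp ρ)
    ?_ ?_ ?_ ?_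
  · rw [Int.card_Icc]; omega
  · rw [map_zlin σ hσ2, hσ0]
  · rw [map_zlin ρ hρ2, hργ]
  · intro θ hθ
    obtain ⟨la, lb, lc⟩ := t.hlog θ hθ
    have lz := (log_all j k θ hθ).1
    apply zpow_prod_lin_dvd (X 0) (rel_X 0 2 (by decide))
    · have := map_dvd ρ (Tmap_dvd_z θ γ lz)
      rwa [hρ2, ← pow_one (X 2)] at this
    · intro s hs
      rw [Finset.mem_Icc] at hs
      by_cases h : -(j : ℤ) ≤ s
      · have := map_dvd ρ (Tmap_dvd θ γ s (lc s (Finset.mem_Icc.2 ⟨h, hs.2⟩)))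
        rwa [map_lin ρ hρ2, hργ] at this
      · have h1 := map_dvd ρ (Tmap_dvd θ α _ (la ((k : ℤ) + j) (Finset.mem_Icc.2 ⟨by omega, le_rfl⟩)))
        rw [map_lin ρ hρ2, hρα, lin] at h1
        have e1 : (C ((k : ℝ) + j) * X 2 - C ((((k : ℤ) + j : ℤ) : ℝ)) * X 2 : S) = 0 := by
          push_cast; ring
        rw [e1, zero_dvd_iff] at h1
        have h2 := map_dvd ρ (Tmap_dvd θ β _ (lb (-(j : ℤ) - s) (Finset.mem_Icc.2 ⟨by omega, by omega⟩)))
        have e2 : ρ (lin β ((-(j : ℤ) - s : ℤ) : ℝ)) = - lin (X 0) (s : ℝ) := by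
          rw [map_lin ρ hρ2, hρβ, lin, lin]
          push_cast
          simp only [map_sub, map_neg]
          ring
        rw [e2, neg_dvd] at h2
        rw [Tmap_sum k α β γ t.hs, map_neg, map_add, h1, zero_add]
        exact h2.neg_right
  · simp [hρ2]
  · simp [hρℓ]
  · have e1 : ((aeval ![(1 / 2 : ℝ), 0, 1]).comp ρ : S →ₐ[ℝ] ℝ) α = (k : ℝ) + j := by
      rw [AlgHom.comp_apply, hρα]; simp
    have e2 : ((aeval ![(1 / 2 : ℝ), 0, 1]).comp ρ : S →ₐ[ℝ] ℝ) β = -(1 / 2) - (j : ℝ) := by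
      rw [AlgHom.comp_apply, hρβ]; simp
    rw [e1, e2]
    exact WW_A j k
  · intro s _
    have e1 : ((aeval ![(1 / 2 : ℝ), 0, 1]).comp ρ : S →ₐ[ℝ] ℝ) γ = 1 / 2 := by
      rw [AlgHom.comp_apply, hργ]; simp
    rw [e1, sub_ne_zero]
    exact half_ne s

lemma coreB {j k : ℕ} {α β γ : S} (t : IsTriple j k α β γ) (ℓ : S) (hℓ : ℓ.IsHomogeneous 1)
    (ρ σ : S →ₐ[ℝ] S) (hρℓ : ρ ℓ = 0) (hσ : ∀ i, ℓ ∣ X i - σ (ρ (X i)))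
    (hρ2 : ρ (X 2) = X 2) (hργ : ρ γ = - (C ((j : ℝ) + 1) * X 2))
    (hρβ : ρ β = C ((k : ℝ) + j + 1) * X 2 - X 0) (hρα : ρ α = X 0)
    (hσ0 : σ (X 0) = α) (hσ2 : σ (X 2) = X 2) :
    ∃ ψ : D0 (fjk j k) →ₗ[S] S ⧸ Ideal.span {ℓ},
      Function.Surjective ψ ∧
      (∀ d : ℕ, 2 * k + 1 + 3 * j ≤ d → ∀ θ : D0 (fjk j k),
        IsHomogDer (θ : Derivation ℝ S S) d →
          ∃ g : S, g.IsHomogeneous (d - (2 * k + 1 + 3 * j)) ∧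
            ψ θ = Ideal.Quotient.mk (Ideal.span {ℓ}) g) ∧
      (∀ d : ℕ, d < 2 * k + 1 + 3 * j → ∀ θ : D0 (fjk j k),
        IsHomogDer (θ : Derivation ℝ S S) d → ψ θ = 0) := by
  refine core t ℓ hℓ ρ σ hρℓ hσ
    (X 2 ^ (k + 2 * j + 2) * ∏ s ∈ Finset.Icc (1 : ℤ) ((k : ℤ) + j), lin α (s : ℝ))
    (X 2 ^ (k + 2 * j + 2) * ∏ s ∈ Finset.Icc (1 : ℤ) ((k : ℤ) + j), lin (X 0) (s : ℝ))
    (zlin_hom α t.ha _ _ _ ?_) ?_ ?_ (zlin_ne _ _) ?_ ((aeval ![(k : ℝ) + j + 1, 0, 1]).comp ρ)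
    ?_ ?_ ?_ ?_
  · rw [Int.card_Icc]; omega
  · rw [map_zlin σ hσ2, hσ0]
  · rw [map_zlin ρ hρ2, hρα]
  · intro θ hθ
    obtain ⟨la, lb, lc⟩ := t.hlog θ hθ
    have lz := (log_all j k θ hθ).1
    apply zpow_prod_lin_dvd (X 0) (rel_X 0 2 (by decide))
    · have h1 : X 2 ^ 1 * ∏ s ∈ Finset.Icc (-(j : ℤ)) ((k : ℤ) + j), lin γ (s : ℝ) ∣ Tmap γ θ := by
        apply zpow_prod_lin_dvd γ t.hrel
        · rw [pow_one]; exact Tmap_dvd_z θ γ lz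
        · intro s hs
          exact Tmap_dvd θ γ s (lc s hs)
      have h2 := map_dvd ρ h1
      rw [map_zlin ρ hρ2] at h2
      refine dvd_trans ?_ h2
      have e : k + 2 * j + 2 = 1 + (Finset.Icc (-(j : ℤ)) ((k : ℤ) + j)).card := by
        rw [Int.card_Icc]; omega
      rw [e, pow_add, ← Finset.prod_const]
      apply mul_dvd_mul dvd_rfl
      apply Finset.prod_dvd_prod_of_dvd
      intro s hs
      rw [Finset.mem_Icc] at hs
      refine ⟨- (C ((j : ℝ) + 1) + C (s : ℝ)), ?_⟩
      rw [hργ, lin]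
      ring
    · intro s hs
      rw [Finset.mem_Icc] at hs
      have h1 := map_dvd ρ (Tmap_dvd θ α _ (la s (Finset.mem_Icc.2 ⟨by omega, hs.2⟩)))
      rw [map_lin ρ hρ2, hρα] at h1
      have h2 := map_dvd ρ (Tmap_dvd θ β _ (lb ((k : ℤ) + j + 1 - s) (Finset.mem_Icc.2 ⟨by omega, by omega⟩)))
      have e2 : ρ (lin β (((k : ℤ) + j + 1 - s : ℤ) : ℝ)) = - lin (X 0) (s : ℝ) := by
        rw [map_lin ρ hρ2, hρβ, lin, lin]
        push_cast
        simp only [map_sub, map_add]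
        ring
      rw [e2, neg_dvd] at h2
      rw [Tmap_sum k α β γ t.hs, map_neg, map_add]
      exact (dvd_add h1 h2).neg_right
  · simp [hρ2]
  · simp [hρℓ]
  · have e1 : ((aeval ![(k : ℝ) + j + 1, 0, 1]).comp ρ : S →ₐ[ℝ] ℝ) α = (k : ℝ) + j + 1 := by
      rw [AlgHom.comp_apply, hρα]; simp
    have e2 : ((aeval ![(k : ℝ) + j + 1, 0, 1]).comp ρ : S →ₐ[ℝ] ℝ) β = 0 := by
      rw [AlgHom.comp_apply, hρβ]; simp
    rw [e1, e2]
    exact WW_B j k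
  · intro s hs
    rw [Finset.mem_Icc] at hs
    have e1 : ((aeval ![(k : ℝ) + j + 1, 0, 1]).comp ρ : S →ₐ[ℝ] ℝ) γ = -((j : ℝ) + 1) := by
      rw [AlgHom.comp_apply, hργ]; simp
    rw [e1]
    have : (-(j : ℝ)) ≤ s := by exact_mod_cast hs.1
    intro h
    linarith

/-- The third member of the basic triple. -/
def tt (k : ℕ) : S := C (k : ℝ) * X 2 - X 0 - X 1

lemma tt_hom (k : ℕ) : (tt k).IsHomogeneous 1 :=
  ((CX_hom _).sub (isHomogeneous_X _ _)).sub (isHomogeneous_X _ _)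

lemma lin_tt (k : ℕ) (s : ℤ) : lin (tt k) (s : ℝ) = - lin (X 0 + X 1) (((k : ℤ) - s : ℤ) : ℝ) := by
  rw [lin, lin, tt]
  push_cast
  simp only [map_sub]
  ring

lemma log_tt (j k : ℕ) (θ : Derivation ℝ S S) :
    LogAlong j k θ (tt k) ↔ LogAlong j k θ (X 0 + X 1) := by
  constructor
  · intro h s hs
    rw [Finset.mem_Icc] at hs
    have := h ((k : ℤ) - s) (Finset.mem_Icc.2 ⟨by omega, by omega⟩)
    rw [lin_tt, map_neg, neg_dvd, dvd_neg, sub_sub_cancel] at this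
    exact this
  · intro h s hs
    rw [Finset.mem_Icc] at hs
    have := h ((k : ℤ) - s) (Finset.mem_Icc.2 ⟨by omega, by omega⟩)
    rw [lin_tt, map_neg, neg_dvd, dvd_neg]
    exact this

lemma der_tt (k : ℕ) (θ : Derivation ℝ S S) :
    θ (tt k) = C (k : ℝ) * θ (X 2) - θ (X 0) - θ (X 1) := by
  simp [tt, Derivation.leibniz, C_mul']

lemma rel_tt (k : ℕ) : IsRelPrime (tt k) (X 2) := by
  have := (linear_irred (X 2 : S) (isHomogeneous_X _ _) (X_ne_zero _))
  apply IsRelPrime.symm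
  rw [this.isRelPrime_iff_not_dvd]
  rintro ⟨q, hq⟩
  have := congrArg (eval ![1, 0, 0]) hq
  simp [tt] at this

lemma hcd_tt (k : ℕ) (θ : Derivation ℝ S S) (d : ℕ) (h : IsHomogDer θ d) :
    (θ (tt k)).IsHomogeneous d := by
  rw [der_tt]
  refine IsHomogeneous.sub (IsHomogeneous.sub ?_ (h 0)) (h 1)
  simpa using (isHomogeneous_C (Fin 3) (k : ℝ)).mul (h 2)

lemma log_all' (j k : ℕ) (θ : Derivation ℝ S S) (hθ : θ ∈ D0 (fjk j k)) :
    LogAlong j k θ (X 0) ∧ LogAlong j k θ (X 1) ∧ LogAlong j k θ (tt k) := by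
  obtain ⟨_, h1, h2, h3⟩ := log_all j k θ hθ
  exact ⟨h1, h2, (log_tt j k θ).2 h3⟩

lemma exists_der (a b : S) : ∃ θ : Derivation ℝ S S, θ (X 2) = 0 ∧ θ (X 0) = a ∧ θ (X 1) = b := by
  refine ⟨mkDerivation ℝ ![a, b, 0], ?_, ?_, ?_⟩ <;> rw [mkDerivation_X] <;> rfl

lemma triple_xyt (j k : ℕ) : IsTriple j k (X 0) (X 1) (tt k) where
  hs := by rw [tt]; ring
  ha := isHomogeneous_X _ _
  hb := isHomogeneous_X _ _
  hc := tt_hom k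
  hlog θ hθ := log_all' j k θ hθ
  hlog' θ hz h0 h1 ht := exists_D0 j k θ hz h0 h1 ((log_tt j k θ).1 ht)
  hder := exists_der
  hrel := rel_tt k
  hcd := hcd_tt k

lemma triple_yxt (j k : ℕ) : IsTriple j k (X 1) (X 0) (tt k) where
  hs := by rw [tt]; ring
  ha := isHomogeneous_X _ _
  hb := isHomogeneous_X _ _
  hc := tt_hom k
  hlog θ hθ := by
    obtain ⟨h0, h1, ht⟩ := log_all' j k θ hθ
    exact ⟨h1, h0, ht⟩
  hlog' θ hz h1 h0 ht := exists_D0 j k θ hz h0 h1 ((log_tt j k θ).1 ht)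
  hder a b := by
    obtain ⟨θ, hz, h0, h1⟩ := exists_der b a
    exact ⟨θ, hz, h1, h0⟩
  hrel := rel_tt k
  hcd := hcd_tt k

lemma triple_tyx (j k : ℕ) : IsTriple j k (tt k) (X 1) (X 0) where
  hs := by rw [tt]; ring
  ha := tt_hom k
  hb := isHomogeneous_X _ _
  hc := isHomogeneous_X _ _
  hlog θ hθ := by
    obtain ⟨h0, h1, ht⟩ := log_all' j k θ hθ
    exact ⟨ht, h1, h0⟩
  hlog' θ hz ht h1 h0 := exists_D0 j k θ hz h0 h1 ((log_tt j k θ).1 ht)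
  hder a b := by
    obtain ⟨θ, hz, h0, h1⟩ := exists_der (- a - b) b
    refine ⟨θ, hz, ?_, h1⟩
    rw [der_tt, hz, h0, h1]; ring
  hrel := rel_X 0 2 (by decide)
  hcd θ d h := h 0

lemma triple_xty (j k : ℕ) : IsTriple j k (X 0) (tt k) (X 1) where
  hs := by rw [tt]; ring
  ha := isHomogeneous_X _ _
  hb := tt_hom k
  hc := isHomogeneous_X _ _
  hlog θ hθ := by
    obtain ⟨h0, h1, ht⟩ := log_all' j k θ hθ
    exact ⟨h0, ht, h1⟩
  hlog' θ hz h0 ht h1 := exists_D0 j k θ hz h0 h1 ((log_tt j k θ).1 ht)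
  hder a b := by
    obtain ⟨θ, hz, h0, h1⟩ := exists_der a (- a - b)
    refine ⟨θ, hz, h0, ?_⟩
    rw [der_tt, hz, h0, h1]; ring
  hrel := rel_X 1 2 (by decide)
  hcd θ d h := h 1

/-- Unstable lines of the Steiner bundle `T_A(2k+1+3j)`: for each of the six listed
linear forms `ℓ`, there is a graded surjection of `S`-modules
`D_0(f_{j,k}) → S/(ℓ)` shifting degrees by `2k+1+3j`. -/
theorem unstable_lines_of_A2_deformation (k j : ℕ) (hk : 3 ≤ k) (ℓ : S)
    (hl : ℓ = X 0 - C ((k : ℝ) + j) * X 2 ∨ ℓ = X 1 - C ((k : ℝ) + j) * X 2 ∨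
      ℓ = X 0 + X 1 + C (j : ℝ) * X 2 ∨ ℓ = X 0 + C ((j : ℝ) + 1) * X 2 ∨
      ℓ = X 1 + C ((j : ℝ) + 1) * X 2 ∨ ℓ = X 0 + X 1 - C ((k : ℝ) + j + 1) * X 2) :
    ∃ ψ : D0 (fjk j k) →ₗ[S] S ⧸ Ideal.span {ℓ},
      Function.Surjective ψ ∧
      (∀ d : ℕ, 2 * k + 1 + 3 * j ≤ d → ∀ θ : D0 (fjk j k),
        IsHomogDer (θ : Derivation ℝ S S) d →
          ∃ g : S, g.IsHomogeneous (d - (2 * k + 1 + 3 * j)) ∧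
            ψ θ = Ideal.Quotient.mk (Ideal.span {ℓ}) g) ∧
      (∀ d : ℕ, d < 2 * k + 1 + 3 * j → ∀ θ : D0 (fjk j k),
        IsHomogDer (θ : Derivation ℝ S S) d → ψ θ = 0) := by
  have hx := isHomogeneous_X ℝ (0 : Fin 3)
  have hy := isHomogeneous_X ℝ (1 : Fin 3)
  rcases hl with rfl | rfl | rfl | rfl | rfl | rfl
  -- x = (k+j) z
  · refine coreA (triple_xyt j k) _ (hx.sub (CX_hom _))
      (aeval ![C ((k : ℝ) + j) * X 2, - X 0 - C (j : ℝ) * X 2, X 2])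
      (aeval ![tt k, 0, X 2]) ?_ ?_ ?_ ?_ ?_ ?_ ?_ ?_
    all_goals first
      | (intro i; fin_cases i)
      | skip
    all_goals simp [tt, algHom_C]
    all_goals first
      | ring1
      | (refine ⟨-1, ?_⟩; ring1)
  -- y = (k+j) z
  · refine coreA (triple_yxt j k) _ (hy.sub (CX_hom _))
      (aeval ![- X 0 - C (j : ℝ) * X 2, C ((k : ℝ) + j) * X 2, X 2])
      (aeval ![tt k, 0, X 2]) ?_ ?_ ?_ ?_ ?_ ?_ ?_ ?_
    all_goals first
      | (intro i; fin_cases i)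
      | skip
    all_goals simp [tt, algHom_C]
    all_goals first
      | ring1
      | (refine ⟨-1, ?_⟩; ring1)
  -- x + y = - j z
  · refine coreA (triple_tyx j k) _ ((hx.add hy).add (CX_hom _))
      (aeval ![X 0, - X 0 - C (j : ℝ) * X 2, X 2])
      (aeval ![X 0, 0, X 2]) ?_ ?_ ?_ ?_ ?_ ?_ ?_ ?_
    all_goals first
      | (intro i; fin_cases i)
      | skip
    all_goals simp [tt, algHom_C]
    all_goals first
      | ring1
      | (refine ⟨1, ?_⟩; ring1)
  -- x = - (j+1) z
  · refine coreB (triple_tyx j k) _ (hx.add (CX_hom _))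
      (aeval ![- (C ((j : ℝ) + 1) * X 2), C ((k : ℝ) + j + 1) * X 2 - X 0, X 2])
      (aeval ![tt k, 0, X 2]) ?_ ?_ ?_ ?_ ?_ ?_ ?_ ?_
    all_goals first
      | (intro i; fin_cases i)
      | skip
    all_goals simp [tt, algHom_C]
    all_goals first
      | ring1
      | (refine ⟨-1, ?_⟩; ring1)
  -- y = - (j+1) z
  · refine coreB (triple_xty j k) _ (hy.add (CX_hom _))
      (aeval ![X 0, - (C ((j : ℝ) + 1) * X 2), X 2])
      (aeval ![X 0, 0, X 2]) ?_ ?_ ?_ ?_ ?_ ?_ ?_ ?_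
    all_goals first
      | (intro i; fin_cases i)
      | skip
    all_goals simp [tt, algHom_C]
    all_goals first
      | ring1
      | (refine ⟨1, ?_⟩; ring1)
  -- x + y = (k+j+1) z
  · refine coreB (triple_xyt j k) _ ((hx.add hy).sub (CX_hom _))
      (aeval ![X 0, C ((k : ℝ) + j + 1) * X 2 - X 0, X 2])
      (aeval ![X 0, 0, X 2]) ?_ ?_ ?_ ?_ ?_ ?_ ?_ ?_
    all_goals first
      | (intro i; fin_cases i)
      | skip
    all_goals simp [tt, algHom_C]
    all_goals first
      | ring1
      | (refine ⟨1, ?_⟩; ring1)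
end
end
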